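/- Let (Ω_t, u, p), t ∈ [0,T), be a C³-regular solution of the quasi-steady two-dimensional Stokes flow with surface tension. Then there exists an independent constant C such that for all t ∈ [0,T): ϑ² ∫_{Ω_t} |∇²u|² dx ≤ r_t ∫_{∂Ω_t} |∂_{τ_t} κ_t|² dH¹ + ϑ² (C/r_t²) ∫_{Ω_t} |∇u|² dx. -/

import Mathlib

open MeasureTheory Metric Set Filter
open scoped RealInnerProductSpace ENNReal Topology NNReal

noncomputable section

abbrev E2 : Type := EuclideanSpace ℝ (Fin 2)

namespace StokesPaper

/-- The `i`-th standard basis vector of `ℝ²`. -/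
def e (i : Fin 2) : E2 := EuclideanSpace.single i (1 : ℝ)

/-- Rotation by +90°; produces the right-handed unit tangent `τ = (-ν₂, ν₁)`
from the outer normal `ν`. -/
def rot (v : E2) : E2 := ⟪v, e 0⟫ • e 1 - ⟪v, e 1⟫ • e 0

/-- The uniform ball condition (UBC) with radius `r`: at every boundary point there are
an open interior ball and an open exterior ball of radius `r` whose boundary spheres
meet exactly at that point. -/
def IsUBCWith (Ω : Set E2) (r : ℝ) : Prop :=
  0 < r ∧ ∀ x ∈ frontier Ω, ∃ cIn cOut : E2,
    ball cIn r ⊆ Ω ∧ ball cOut r ⊆ Ωᶜ ∧ sphere cIn r ∩ sphere cOut r = {x}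

/-- A UBC domain: a bounded domain satisfying the UBC for some radius. -/
def IsUBCDomain (Ω : Set E2) : Prop :=
  IsOpen Ω ∧ IsConnected Ω ∧ Bornology.IsBounded Ω ∧ ∃ r : ℝ, IsUBCWith Ω r

/-- The maximal UBC radius `r_Ω`. -/
def ubcRadius (Ω : Set E2) : ℝ := sSup {r : ℝ | IsUBCWith Ω r}

/-- The perimeter `P(Ω) = H¹(∂Ω)`. -/
def perim (Ω : Set E2) : ℝ := (μH[1] (frontier Ω)).toReal

/-- The area `|Ω|`. -/
def area (Ω : Set E2) : ℝ := (volume Ω).toReal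

/-- Boundary integral with respect to the 1-dimensional Hausdorff measure. -/
def bInt (Ω : Set E2) (f : E2 → ℝ) : ℝ := ∫ x in frontier Ω, f x ∂μH[1]

open Classical in
/-- The signed distance function `d_Ω` (negative inside `Ω`). -/
def sdist (Ω : Set E2) (x : E2) : ℝ :=
  if x ∈ Ω then -(infDist x (frontier Ω)) else infDist x Ω

/-- The tubular neighborhood `N_r(∂Ω)`. -/
def tubNbhd (Ω : Set E2) (r : ℝ) : Set E2 := {x : E2 | infDist x (frontier Ω) < r}

/-- Pointwise vector Laplacian. -/
def vLap (u : E2 → E2) (x : E2) : E2 :=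
  ∑ i : Fin 2, fderiv ℝ (fderiv ℝ u) x (e i) (e i)

/-- Pointwise gradient of a scalar function. -/
def gradv (f : E2 → ℝ) (x : E2) : E2 := ∑ i : Fin 2, fderiv ℝ f x (e i) • e i

/-- Pointwise divergence of a vector field. -/
def divg (u : E2 → E2) (x : E2) : ℝ := ∑ i : Fin 2, ⟪fderiv ℝ u x (e i), e i⟫

/-- The entry `(∇u)_{ij} = ∂_j u_i` of the gradient matrix. -/
def gradEntry (u : E2 → E2) (x : E2) (i j : Fin 2) : ℝ := ⟪fderiv ℝ u x (e j), e i⟫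

/-- The entry of the symmetric gradient `∇_sym u = (∇u + (∇u)ᵀ)/2`. -/
def symGradEntry (u : E2 → E2) (x : E2) (i j : Fin 2) : ℝ :=
  (gradEntry u x i j + gradEntry u x j i) / 2

/-- The symmetric gradient applied to a vector. -/
def symGradApp (u : E2 → E2) (x v : E2) : E2 :=
  ∑ i : Fin 2, (∑ j : Fin 2, symGradEntry u x i j * ⟪v, e j⟫) • e i

/-- Squared Frobenius norm `|∇u|²`. -/
def gradNormSq (u : E2 → E2) (x : E2) : ℝ :=
  ∑ i : Fin 2, ∑ j : Fin 2, (gradEntry u x i j)^2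

/-- Squared Frobenius norm `|∇_sym u|²`. -/
def symGradNormSq (u : E2 → E2) (x : E2) : ℝ :=
  ∑ i : Fin 2, ∑ j : Fin 2, (symGradEntry u x i j)^2

/-- `ν` is the outer unit normal of `Ω` at the boundary point `x`, characterized via the
interior and exterior tangent balls of the uniform ball condition. -/
def IsOuterNormalAt (Ω : Set E2) (x ν : E2) : Prop :=
  ‖ν‖ = 1 ∧ ∀ r : ℝ, IsUBCWith Ω r →
    ball (x - r • ν) r ⊆ Ω ∧ ball (x + r • ν) r ⊆ Ωᶜ

/-- `∫_Ω |∇^k u|² dx`. -/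
def derivSq (k : ℕ) (Ω : Set E2) (u : E2 → E2) : ℝ :=
  ∫ x in Ω, ‖iteratedFDeriv ℝ k u x‖^2

/-- Squared Sobolev norm `‖u‖²_{H^n(Ω)}`. -/
def hSobSq (n : ℕ) (Ω : Set E2) (u : E2 → E2) : ℝ :=
  ∑ k ∈ Finset.range (n + 1), derivSq k Ω u


/-- A `C^k`-regular solution of the quasi-steady two-dimensional Stokes flow with
surface tension on the time interval `[0, T)`, with viscosity constant `ϑ`.
The fields `nu` and `kappa` are the outer unit normal and the scalar curvature of the
moving boundary (given together with local `C^{k-1}`-, resp. `C^{k-2}`-regular extensions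
to a neighborhood of the boundary); the curvature satisfies the Weingarten relation
`κ = ⟨∂_τ ν, τ⟩`. -/
structure RegularSolution (k : ℕ) (T ϑ : ℝ) where
  Ω : ℝ → Set E2
  u : ℝ → E2 → E2
  p : ℝ → E2 → ℝ
  nu : ℝ → E2 → E2
  kappa : ℝ → E2 → ℝ
  k_ge : 2 ≤ k
  T_pos : 0 < T
  theta_pos : 0 < ϑ
  isOpen : ∀ t ∈ Ico (0:ℝ) T, IsOpen (Ω t)
  isConnected : ∀ t ∈ Ico (0:ℝ) T, IsConnected (Ω t)
  isBounded : ∀ t ∈ Ico (0:ℝ) T, Bornology.IsBounded (Ω t)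
  ubc : ∀ t ∈ Ico (0:ℝ) T, ∃ r : ℝ, IsUBCWith (Ω t) r
  u_reg : ∀ t ∈ Ico (0:ℝ) T, ContDiffOn ℝ k (u t) (closure (Ω t))
  p_reg : ∀ t ∈ Ico (0:ℝ) T, ContDiffOn ℝ (k - 1 : ℕ) (p t) (closure (Ω t))
  nu_reg : ∀ t ∈ Ico (0:ℝ) T, ∃ U : Set E2, IsOpen U ∧ frontier (Ω t) ⊆ U ∧
    ContDiffOn ℝ (k - 1 : ℕ) (nu t) U
  nu_normal : ∀ t ∈ Ico (0:ℝ) T, ∀ x ∈ frontier (Ω t), IsOuterNormalAt (Ω t) x (nu t x)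
  kappa_reg : ∀ t ∈ Ico (0:ℝ) T, ∃ U : Set E2, IsOpen U ∧ frontier (Ω t) ⊆ U ∧
    ContDiffOn ℝ (k - 2 : ℕ) (kappa t) U
  kappa_eq : ∀ t ∈ Ico (0:ℝ) T, ∀ x ∈ frontier (Ω t),
    kappa t x = ⟪fderiv ℝ (nu t) x (rot (nu t x)), rot (nu t x)⟫
  stokes : ∀ t ∈ Ico (0:ℝ) T, ∀ x ∈ Ω t, ϑ • vLap (u t) x = gradv (p t) x
  incomp : ∀ t ∈ Ico (0:ℝ) T, ∀ x ∈ Ω t, divg (u t) x = 0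
  bdry_cond : ∀ t ∈ Ico (0:ℝ) T, ∀ x ∈ frontier (Ω t),
    kappa t x • nu t x = p t x • nu t x - (2 * ϑ) • symGradApp (u t) x (nu t x)
  mom_zero : ∀ t ∈ Ico (0:ℝ) T, (∫ x in Ω t, u t x) = 0
  mom_sym : ∀ t ∈ Ico (0:ℝ) T, ∀ i j : Fin 2,
    (∫ x in Ω t, gradEntry (u t) x i j) = ∫ x in Ω t, gradEntry (u t) x j i
  normal_velocity : ∀ t ∈ Ico (0:ℝ) T, ∀ x ∈ frontier (Ω t), ∃ s : ℝ → ℝ,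
    s 0 = 0 ∧
    (∀ᶠ h in 𝓝 (0:ℝ), t + h ∈ Ico (0:ℝ) T →
      (x + s h • nu t x ∈ frontier (Ω (t + h)) ∧
        ∀ a : ℝ, x + a • nu t x ∈ frontier (Ω (t + h)) → |s h| ≤ |a|)) ∧
    HasDerivAt s (⟪u t x, nu t x⟫) 0
  spacetime_cont : ∀ l : ℕ, l ≤ k →
    ContinuousOn (fun q : ℝ × E2 => iteratedFDeriv ℝ l (u q.1) q.2)
      {q : ℝ × E2 | q.1 ∈ Ico (0:ℝ) T ∧ q.2 ∈ closure (Ω q.1)}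

namespace RegularSolution

variable {k : ℕ} {T ϑ : ℝ}

/-- The maximal UBC radius `r_t` of `Ω_t`. -/
def r (sol : RegularSolution k T ϑ) (t : ℝ) : ℝ := ubcRadius (sol.Ω t)

/-- The perimeter `P_t` of `Ω_t`. -/
def P (sol : RegularSolution k T ϑ) (t : ℝ) : ℝ := perim (sol.Ω t)

/-- The right-handed unit tangent `τ_t`. -/
def tau (sol : RegularSolution k T ϑ) (t : ℝ) (x : E2) : E2 := rot (sol.nu t x)

/-- The tangential derivative `∂_{τ_t} κ_t` of the curvature. -/
def dtauKappa (sol : RegularSolution k T ϑ) (t : ℝ) (x : E2) : ℝ :=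
  fderiv ℝ (sol.kappa t) x (sol.tau t x)

/-- `∫_{∂Ω_t} κ_t² dH¹`, i.e. `‖κ_t‖²_{L²(∂Ω_t)}`. -/
def curvSq (sol : RegularSolution k T ϑ) (t : ℝ) : ℝ :=
  bInt (sol.Ω t) (fun x => (sol.kappa t x)^2)

/-- `∫_{∂Ω_t} |∂_{τ_t} κ_t|² dH¹`, i.e. `‖∂_{τ_t} κ_t‖²_{L²(∂Ω_t)}`. -/
def dcurvSq (sol : RegularSolution k T ϑ) (t : ℝ) : ℝ :=
  bInt (sol.Ω t) (fun x => (sol.dtauKappa t x)^2)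

/-- The constant `K₀` defined by `arctan K₀ = (arctan ‖∂_{τ₀}κ₀‖²_{L²} + π/2)/2`. -/
def K0 (sol : RegularSolution k T ϑ) : ℝ :=
  Real.tan ((Real.arctan (sol.dcurvSq 0) + Real.pi / 2) / 2)

/-- The threshold time `T̃₀`. -/
def tildeT (sol : RegularSolution k T ϑ) : ℝ :=
  sSup {t : ℝ | 0 ≤ t ∧ t < T ∧ ∀ s ∈ Icc (0:ℝ) t,
    sol.r 0 / 2 ≤ sol.r s ∧ sol.dcurvSq s ≤ sol.K0}

end RegularSolution

section

/-- partial derivative -/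
def D (i : Fin 2) (f : E2 → ℝ) (x : E2) : ℝ := fderiv ℝ f x (e i)

/-- Lipschitz with a real constant -/
def Lp (K : ℝ) (f : E2 → ℝ) : Prop := ∀ x y, |f x - f y| ≤ K * ‖x - y‖

lemma e_apply (i j : Fin 2) : (e i) j = if j = i then 1 else 0 := by
  unfold e; simp

lemma inner_e (x : E2) (i : Fin 2) : ⟪x, e i⟫ = x i := by
  unfold e; simp [EuclideanSpace.inner_single_right]

lemma inner_two (x y : E2) : ⟪x, y⟫ = x 0 * y 0 + x 1 * y 1 := by
  simp [PiLp.inner_apply, Fin.sum_univ_two]; ring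

lemma norm_e (i : Fin 2) : ‖e i‖ = 1 := by unfold e; simp

lemma norm_sq_two (x : E2) : ‖x‖ ^ 2 = x 0 ^ 2 + x 1 ^ 2 := by
  rw [EuclideanSpace.real_norm_sq_eq, Fin.sum_univ_two]

lemma abs_apply_le (x : E2) (i : Fin 2) : |x i| ≤ ‖x‖ := by
  rw [← inner_e x i]
  calc |⟪x, e i⟫| ≤ ‖x‖ * ‖e i‖ := abs_real_inner_le_norm _ _
    _ = ‖x‖ := by rw [norm_e, mul_one]

lemma eq_sum_e (x : E2) : x = x 0 • e 0 + x 1 • e 1 := by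
  ext i; fin_cases i <;> simp [e_apply]

lemma rot_0 (v : E2) : (rot v) 0 = - v 1 := by simp [rot, inner_e, e_apply]
lemma rot_1 (v : E2) : (rot v) 1 = v 0 := by simp [rot, inner_e, e_apply]

structure Geo (Ω : Set E2) (r : ℝ) (ν : E2 → E2) : Prop where
  rpos : 0 < r
  op : IsOpen Ω
  bd : Bornology.IsBounded Ω
  ne : Ω.Nonempty
  unit : ∀ x ∈ frontier Ω, ‖ν x‖ = 1
  inn : ∀ x ∈ frontier Ω, ball (x - r • ν x) r ⊆ Ω
  out : ∀ x ∈ frontier Ω, ball (x + r • ν x) r ⊆ Ωᶜ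

namespace Geo
variable {Ω : Set E2} {r : ℝ} {ν : E2 → E2}

lemma lip (G : Geo Ω r ν) {x y : E2} (hx : x ∈ frontier Ω) (hy : y ∈ frontier Ω) :
    ‖ν x - ν y‖ ≤ ‖x - y‖ / r := by
  have hr := G.rpos
  have key : ∀ a ∈ frontier Ω, ∀ b ∈ frontier Ω, (2*r)^2 ≤ ‖(a - b) - r • (ν a + ν b)‖^2 := by
    intro a ha b hb
    have hd : Disjoint (ball (a - r • ν a) r) (ball (b + r • ν b) r) := by
      rw [Set.disjoint_left]
      intro z h1 h2
      exact G.out b hb h2 (G.inn a ha h1)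
    rw [disjoint_ball_ball_iff hr hr, dist_eq_norm] at hd
    have : a - r • ν a - (b + r • ν b) = (a - b) - r • (ν a + ν b) := by
      rw [smul_add]; abel
    rw [this] at hd
    have : 2 * r = r + r := by ring
    rw [this]
    gcongr
  have h1 := key x hx y hy
  have h2 := key y hy x hx
  have nx := G.unit x hx
  have ny := G.unit y hy
  have nx2 : ‖ν x‖^2 = 1 := by rw [nx]; norm_num
  have ny2 : ‖ν y‖^2 = 1 := by rw [ny]; norm_num
  rw [norm_sq_two] at h1 h2 nx2 ny2
  simp at h1 h2
  rw [le_div_iff₀ hr]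
  apply le_of_sq_le_sq _ (norm_nonneg _) |> fun h => h
  rw [mul_pow, norm_sq_two, norm_sq_two]
  simp
  nlinarith

lemma compl_ne (G : Geo Ω r ν) : (Ωᶜ).Nonempty := by
  rw [nonempty_compl]
  intro h
  have := G.bd
  rw [h] at this
  exact NormedSpace.unbounded_univ ℝ E2 this

lemma compact_cl (G : Geo Ω r ν) : IsCompact (closure Ω) := G.bd.isCompact_closure

lemma compact_fr (G : Geo Ω r ν) : IsCompact (frontier Ω) :=
  G.compact_cl.of_isClosed_subset isClosed_frontier frontier_subset_closure

end Geo

/-- distance to the complement -/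
def dd (Ω : Set E2) (x : E2) : ℝ := infDist x Ωᶜ

lemma dd_nonneg (Ω : Set E2) (x : E2) : 0 ≤ dd Ω x := infDist_nonneg

lemma dd_lp (Ω : Set E2) : Lp 1 (dd Ω) := by
  intro x y
  have := (lipschitz_infDist_pt (Ωᶜ)).dist_le_mul x y
  simpa [dist_eq_norm, dd, Real.norm_eq_abs] using this

lemma dd_out {Ω : Set E2} {x : E2} (hx : x ∉ Ω) : dd Ω x = 0 :=
  infDist_zero_of_mem hx

lemma not_mem_of_frontier {Ω : Set E2} (h : IsOpen Ω) {x : E2} (hx : x ∈ frontier Ω) : x ∉ Ω := by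
  rw [h.frontier_eq] at hx; exact hx.2

namespace Geo
variable {Ω : Set E2} {r : ℝ} {ν : E2 → E2}

lemma dd_pos (G : Geo Ω r ν) {x : E2} (hx : x ∈ Ω) : 0 < dd Ω x := by
  apply (G.op.isClosed_compl.notMem_iff_infDist_pos G.compl_ne).1
  simpa using hx

lemma proj (G : Geo Ω r ν) {x : E2} (hx : x ∈ Ω) :
    ∃ y ∈ frontier Ω, ‖x - y‖ = dd Ω x ∧ x - y = - (dd Ω x • ν y) := by
  have hr := G.rpos
  obtain ⟨y, hy, hxy⟩ := G.op.isClosed_compl.exists_infDist_eq_dist G.compl_ne x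
  have hd := G.dd_pos hx
  set d := dd Ω x with hd'
  have hdist : d = dist x y := hxy
  have hball : ball x d ⊆ Ω := by
    intro z hz
    by_contra hz'
    have : d ≤ dist x z := infDist_le_dist_of_mem (s := Ωᶜ) hz'
    rw [mem_ball, dist_comm] at hz
    linarith
  have hyf : y ∈ frontier Ω := by
    rw [G.op.frontier_eq]
    refine ⟨?_, hy⟩
    have : y ∈ closure (ball x d) := by
      rw [closure_ball x hd.ne']
      simp [dist_comm y x, hdist]
    exact closure_mono hball this
  refine ⟨y, hyf, by rw [hdist, dist_eq_norm], ?_⟩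
  have hdj : Disjoint (ball x d) (ball (y + r • ν y) r) := by
    rw [Set.disjoint_left]
    intro z h1 h2
    exact G.out y hyf h2 (hball h1)
  rw [disjoint_ball_ball_iff hd hr, dist_eq_norm] at hdj
  have h3 : (d + r)^2 ≤ ‖x - (y + r • ν y)‖^2 := by gcongr
  have h4 : ‖x - y‖^2 = d^2 := by rw [hdist, dist_eq_norm]
  have ny2 : ‖ν y‖^2 = 1 := by rw [G.unit y hyf]; norm_num
  rw [norm_sq_two] at h3 h4 ny2
  simp at h3 h4
  have h5 : (x 0 - y 0) * ν y 0 + (x 1 - y 1) * ν y 1 ≤ - d := by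
    have : r * ((x 0 - y 0) * ν y 0 + (x 1 - y 1) * ν y 1) ≤ r * (- d) := by
      have e1 : r^2 * (ν y 0 ^2 + ν y 1 ^2) = r^2 := by rw [ny2, mul_one]
      nlinarith
    exact le_of_mul_le_mul_left this hr
  have h6 : ‖x - y + d • ν y‖^2 ≤ 0 := by
    rw [norm_sq_two]; simp
    nlinarith
  have h7 : x - y + d • ν y = 0 := by
    rw [← norm_eq_zero]
    have := norm_nonneg (x - y + d • ν y)
    nlinarith
  exact eq_neg_of_add_eq_zero_left h7

lemma dd_fderiv (G : Geo Ω r ν) {x y : E2} (hx : x ∈ Ω) (hy : y ∈ frontier Ω)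
    (h2 : x - y = - (dd Ω x • ν y)) (hdiff : DifferentiableAt ℝ (dd Ω) x) (i : Fin 2) :
    D i (dd Ω) x = - ν y i := by
  set L := fderiv ℝ (dd Ω) x with hL
  have hLf : HasFDerivAt (dd Ω) L x := hdiff.hasFDerivAt
  have hn : ‖L‖ ≤ 1 := by
    have := norm_fderiv_le_of_lipschitz ℝ (f := dd Ω) (x₀ := x) (lipschitz_infDist_pt (Ωᶜ))
    simpa using this
  have hd := G.dd_pos hx
  have hy1 := G.unit y hy
  have hLn : L (ν y) ≤ -1 := by
    have hline : HasDerivAt (fun s : ℝ => dd Ω (x + s • ν y)) (L (ν y)) 0 := by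
      have := hLf.hasLineDerivAt (ν y)
      exact this
    have ht := hline.tendsto_slope_zero_right
    refine le_of_tendsto ht ?_
    filter_upwards [Ioo_mem_nhdsGT hd] with s hs
    have h3 : dd Ω (x + s • ν y) ≤ dd Ω x - s := by
      have hyc : y ∈ Ωᶜ := not_mem_of_frontier G.op hy
      have := infDist_le_dist_of_mem (x := x + s • ν y) hyc
      refine this.trans (le_of_eq ?_)
      rw [dist_eq_norm]
      have : x + s • ν y - y = - ((dd Ω x - s) • ν y) := by
        have e1 : x + s • ν y - y = (x - y) + s • ν y := by abel
        rw [e1, h2, sub_smul]; abel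
      rw [this, norm_neg, norm_smul, hy1, mul_one, Real.norm_eq_abs, abs_of_pos]
      linarith [hs.2]
    have : s⁻¹ * (dd Ω (x + s • ν y) - dd Ω x) ≤ -1 := by
      rw [inv_mul_le_iff₀ hs.1]; linarith
    simpa using this
  have hy2 : ν y 0 ^2 + ν y 1 ^2 = 1 := by rw [← norm_sq_two, hy1]; norm_num
  have hLs : L (ν y) = ν y 0 * L (e 0) + ν y 1 * L (e 1) := by
    conv_lhs => rw [eq_sum_e (ν y)]
    simp
  have hLg : L (e 0)^2 + L (e 1)^2 ≤ 1 := by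
    set g : E2 := L (e 0) • e 0 + L (e 1) • e 1
    have hg : L g = L (e 0)^2 + L (e 1)^2 := by simp [g]; ring
    have hgn : ‖g‖^2 = L (e 0)^2 + L (e 1)^2 := by
      rw [norm_sq_two]; simp [g, e_apply]
    have h1 : L g ≤ 1 * ‖g‖ := (le_abs_self _).trans (L.le_of_opNorm_le hn g)
    rw [hg, ← hgn] at h1
    rw [← hgn]
    have := norm_nonneg g
    by_contra hc
    nlinarith
  have h8 : (L (e 0) + ν y 0)^2 + (L (e 1) + ν y 1)^2 ≤ 0 := by
    rw [hLs] at hLn; nlinarith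
  have a0 : L (e 0) + ν y 0 = 0 := by
    have := sq_nonneg (L (e 0) + ν y 0); have := sq_nonneg (L (e 1) + ν y 1)
    exact pow_eq_zero_iff (two_ne_zero) |>.1 (by linarith)
  have a1 : L (e 1) + ν y 1 = 0 := by
    have := sq_nonneg (L (e 0) + ν y 0); have := sq_nonneg (L (e 1) + ν y 1)
    exact pow_eq_zero_iff (two_ne_zero) |>.1 (by linarith)
  unfold D
  fin_cases i
  · exact eq_neg_of_add_eq_zero_left a0
  · exact eq_neg_of_add_eq_zero_left a1

lemma exists_ext (G : Geo Ω r ν) : ∃ n : Fin 2 → E2 → ℝ, (∀ i, Lp (1/r) (n i)) ∧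
    (∀ i x, |n i x| ≤ 1) ∧ ∀ i, ∀ x ∈ frontier Ω, n i x = ν x i := by
  have hr := G.rpos
  have : ∀ i : Fin 2, ∃ n : E2 → ℝ, Lp (1/r) n ∧ (∀ x, |n x| ≤ 1) ∧
      ∀ x ∈ frontier Ω, n x = ν x i := by
    intro i
    have hl : LipschitzOnWith (1/r).toNNReal (fun x => ν x i) (frontier Ω) := by
      apply LipschitzOnWith.of_dist_le_mul
      intro x hx y hy
      rw [Real.coe_toNNReal _ (by positivity), dist_eq_norm, dist_eq_norm, Real.norm_eq_abs]
      have := abs_apply_le (ν x - ν y) i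
      have h2 := G.lip hx hy
      simp at this
      calc _ ≤ _ := this
        _ ≤ _ := h2
        _ = _ := by ring
    obtain ⟨g, hg, hgE⟩ := hl.extend_real
    refine ⟨fun x => min (max (g x) (-1)) 1, ?_, ?_, ?_⟩
    · intro x y
      have := ((hg.max_const (-1)).min_const 1).dist_le_mul x y
      rwa [Real.coe_toNNReal _ (by positivity), dist_eq_norm, dist_eq_norm, Real.norm_eq_abs] at this
    · intro x
      rw [abs_le]
      refine ⟨le_min (le_max_right _ _) (by norm_num), min_le_right _ _⟩
    · intro x hx
      have h1 := abs_apply_le (ν x) i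
      rw [G.unit x hx, abs_le] at h1
      have h2 : g x = ν x i := (hgE hx).symm
      simp only [h2]
      rw [max_eq_left h1.1, min_eq_left h1.2]
  choose n h1 h2 h3 using this
  exact ⟨n, h1, h2, h3⟩

end Geo

lemma Lp.lipschitz {K : ℝ} {f : E2 → ℝ} (h : Lp K f) : LipschitzWith K.toNNReal f := by
  apply LipschitzWith.of_dist_le_mul
  intro x y
  rw [dist_eq_norm, dist_eq_norm, Real.norm_eq_abs]
  refine (h x y).trans ?_
  gcongr
  exact Real.le_coe_toNNReal K

lemma Lp.continuous {K : ℝ} {f : E2 → ℝ} (h : Lp K f) : Continuous f := h.lipschitz.continuous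

lemma Lp.nonneg {K : ℝ} {f : E2 → ℝ} (h : Lp K f) : 0 ≤ K := by
  have := (abs_nonneg _).trans (h (e 0) 0)
  simpa [norm_e] using this

lemma Lp.D_le {K : ℝ} {f : E2 → ℝ} (h : Lp K f) (i : Fin 2) (x : E2) : |D i f x| ≤ K := by
  have h1 := norm_fderiv_le_of_lipschitz ℝ (x₀ := x) h.lipschitz
  rw [Real.coe_toNNReal _ h.nonneg] at h1
  have := (fderiv ℝ f x).le_of_opNorm_le h1 (e i)
  rwa [norm_e, mul_one, Real.norm_eq_abs] at this

lemma Lp.ae_diff {K : ℝ} {f : E2 → ℝ} (h : Lp K f) : ∀ᵐ x : E2, DifferentiableAt ℝ f x :=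
  h.lipschitz.ae_differentiableAt

lemma Lp.mul {K L A B : ℝ} {f g : E2 → ℝ} (hf : Lp K f) (hg : Lp L g)
    (fA : ∀ x, |f x| ≤ A) (gB : ∀ x, |g x| ≤ B) : Lp (A * L + B * K) (fun x => f x * g x) := by
  intro x y
  have : f x * g x - f y * g y = f x * (g x - g y) + g y * (f x - f y) := by ring
  rw [this]
  calc _ ≤ |f x| * |g x - g y| + |g y| * |f x - f y| := by
        refine (abs_add_le _ _).trans ?_; rw [abs_mul, abs_mul]
    _ ≤ A * (L * ‖x - y‖) + B * (K * ‖x-y‖) := by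
        have := (abs_nonneg _).trans (fA x)
        have := (abs_nonneg _).trans (gB x)
        gcongr
        · exact fA x
        · exact hg x y
        · exact gB y
        · exact hf x y
    _ = _ := by ring

lemma Lp.mono {K L : ℝ} {f : E2 → ℝ} (hf : Lp K f) (h : K ≤ L) : Lp L f := fun x y =>
  (hf x y).trans (by gcongr)

lemma Lp.comp {K L : ℝ} {f : E2 → ℝ} {g : ℝ → ℝ} (hf : Lp K f) (hL : 0 ≤ L)
    (hg : ∀ a b, |g a - g b| ≤ L * |a - b|) :
    Lp (L * K) (fun x => g (f x)) := fun x y =>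
  (hg _ _).trans (by rw [mul_assoc]; gcongr; exact hf x y)

lemma Lp.sub {K L : ℝ} {f g : E2 → ℝ} (hf : Lp K f) (hg : Lp L g) :
    Lp (K + L) (fun x => f x - g x) := fun x y => by
  have : f x - g x - (f y - g y) = (f x - f y) - (g x - g y) := by ring
  rw [this, add_mul]
  exact (abs_sub _ _).trans (add_le_add (hf x y) (hg x y))

lemma Lp.const (c : ℝ) : Lp 0 (fun _ => c) := fun x y => by simp

lemma Geo.ae_dd {Ω : Set E2} {r : ℝ} {ν : E2 → E2} (G : Geo Ω r ν) {n : Fin 2 → E2 → ℝ}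
    (hn : ∀ i, Lp (1/r) (n i)) (hnf : ∀ i, ∀ x ∈ frontier Ω, n i x = ν x i) :
    ∀ᵐ x : E2, x ∈ Ω → DifferentiableAt ℝ (dd Ω) x ∧ D 0 (dd Ω) x ^ 2 + D 1 (dd Ω) x ^2 = 1 ∧
      ∀ i, |D i (dd Ω) x + n i x| ≤ dd Ω x / r := by
  filter_upwards [(dd_lp Ω).ae_diff] with x hx hxO
  obtain ⟨y, hy, h1, h2⟩ := G.proj hxO
  have h := G.dd_fderiv hxO hy h2 hx
  refine ⟨hx, ?_, ?_⟩
  · rw [h, h, neg_sq, neg_sq, ← norm_sq_two, G.unit y hy]; norm_num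
  · intro i
    rw [h i, ← hnf i y hy]
    have := hn i x y
    rw [h1] at this
    rw [neg_add_eq_sub]
    calc _ ≤ _ := this
      _ = _ := by ring


end

section

/-- Cutoff profile -/
def th (s : ℝ) : ℝ := Real.smoothTransition (s - 1)

lemma th_contDiff : ContDiff ℝ 1 th := by
  have : ContDiff ℝ ((1 : ℕ∞) : WithTop ℕ∞) Real.smoothTransition := Real.smoothTransition.contDiff
  exact this.comp (contDiff_id.sub contDiff_const)

lemma th_zero {s : ℝ} (h : s ≤ 1) : th s = 0 := Real.smoothTransition.zero_of_nonpos (by linarith)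
lemma th_one {s : ℝ} (h : 2 ≤ s) : th s = 1 := Real.smoothTransition.one_of_one_le (by linarith)
lemma th_nonneg (s : ℝ) : 0 ≤ th s := Real.smoothTransition.nonneg _
lemma th_le_one (s : ℝ) : th s ≤ 1 := Real.smoothTransition.le_one _
lemma th_mono : Monotone th := fun _ _ h => Real.smoothTransition.monotone (by linarith)
lemma th_hasDeriv (s : ℝ) : HasDerivAt th (deriv th s) s :=
  ((th_contDiff.differentiable one_ne_zero) s).hasDerivAt
lemma dth_cont : Continuous (deriv th) := th_contDiff.continuous_deriv le_rfl
lemma dth_nonneg (s : ℝ) : 0 ≤ deriv th s := th_mono.deriv_nonneg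

lemma dth_zero_left {s : ℝ} (h : s < 1) : deriv th s = 0 := by
  have : th =ᶠ[𝓝 s] fun _ => 0 := by
    filter_upwards [Iio_mem_nhds h] with a ha using th_zero (le_of_lt ha)
  rw [this.deriv_eq]; simp

lemma dth_zero_right {s : ℝ} (h : 2 < s) : deriv th s = 0 := by
  have : th =ᶠ[𝓝 s] fun _ => 1 := by
    filter_upwards [Ioi_mem_nhds h] with a ha using th_one (le_of_lt ha)
  rw [this.deriv_eq]; simp

lemma dth_bound : ∃ A : ℝ, 1 ≤ A ∧ ∀ s, deriv th s ≤ A := by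
  obtain ⟨A, hA⟩ := (isCompact_Icc (a := (1:ℝ)) (b := 2)).exists_bound_of_continuousOn
    dth_cont.continuousOn
  refine ⟨max A 1, le_max_right _ _, fun s => ?_⟩
  by_cases h1 : s < 1
  · rw [dth_zero_left h1]; positivity
  by_cases h2 : 2 < s
  · rw [dth_zero_right h2]; positivity
  exact (le_abs_self _).trans ((hA s ⟨not_lt.1 h1, not_lt.1 h2⟩).trans (le_max_left _ _))

def thA : ℝ := dth_bound.choose
lemma thA_one : 1 ≤ thA := dth_bound.choose_spec.1
lemma dth_le (s : ℝ) : deriv th s ≤ thA := dth_bound.choose_spec.2 s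

lemma th_lip (a b : ℝ) : |th a - th b| ≤ thA * |a - b| := by
  have hA : (0:ℝ) ≤ thA := zero_le_one.trans thA_one
  have := Convex.norm_image_sub_le_of_norm_deriv_le (f := th) (C := thA) (s := univ) (x := b) (y := a)
    (fun x _ => (th_hasDeriv x).differentiableAt)
    (fun x _ => by rw [Real.norm_eq_abs, abs_of_nonneg (dth_nonneg x)]; exact dth_le x)
    convex_univ (mem_univ _) (mem_univ _)
  simpa [Real.norm_eq_abs] using this

/-- integration by parts against a Lipschitz function compactly supported in `Ω` -/
lemma ibp {Ω S : Set E2} (hΩ : IsOpen Ω) (hS : IsCompact S) (hSΩ : S ⊆ Ω) {K : ℝ} {c g : E2 → ℝ}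
    (hc : Lp K c) (hcS : ∀ x, x ∉ S → c x = 0) (hg : ContDiffOn ℝ 1 g Ω) (i : Fin 2) :
    ∫ x in Ω, D i c x * g x = - ∫ x in Ω, c x * D i g x := by
  obtain ⟨K', hK', hSK, hKΩ⟩ := exists_compact_between hS hΩ hSΩ
  obtain ⟨ζ, h1, h0, -⟩ := exists_contMDiffMap_one_nhds_of_subset_interior
    (n := (1 : ℕ∞)) (modelWithCornersSelf ℝ E2) hS.isClosed hSK
  have hζ : ContDiff ℝ 1 ζ := ζ.contMDiff.contDiff
  set f : E2 → ℝ := fun x => ζ x * g x with hf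
  have hsup : tsupport f ⊆ K' := by
    apply closure_minimal _ hK'.isClosed
    intro x hx
    by_contra hxK
    exact hx (by simp [hf, h0 x hxK])
  have hfc : HasCompactSupport f := hK'.of_isClosed_subset (isClosed_tsupport f) hsup
  have hfd : ContDiff ℝ 1 f := by
    rw [contDiff_iff_contDiffAt]
    intro x
    by_cases hx : x ∈ Ω
    · exact hζ.contDiffAt.mul (hg.contDiffAt (hΩ.mem_nhds hx))
    · have : f =ᶠ[𝓝 x] fun _ => 0 := by
        filter_upwards [hK'.isClosed.isOpen_compl.mem_nhds (fun h => hx (hKΩ h))] with y hy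
        simp [hf, h0 y hy]
      exact contDiffAt_const.congr_of_eventuallyEq this
  obtain ⟨C, hC⟩ := ContDiff.lipschitzWith_of_hasCompactSupport hfc hfd one_ne_zero
  have key := hc.lipschitz.integral_lineDeriv_mul_eq (μ := volume) hC hfc (e i)
  have hcs : ∀ x, x ∉ S → D i c x = 0 := by
    intro x hx
    have : c =ᶠ[𝓝 x] fun _ => 0 := by
      filter_upwards [hS.isClosed.isOpen_compl.mem_nhds hx] with y hy using hcS y hy
    unfold D; rw [this.fderiv_eq]; simp
  have hfS : ∀ x ∈ S, f =ᶠ[𝓝 x] g := by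
    intro x hx
    have := eventually_nhdsSet_iff_forall.1 h1 x hx
    filter_upwards [this] with y hy
    simp [hf, hy]
  have eL : ∫ x, lineDeriv ℝ c x (e i) * f x = ∫ x in Ω, D i c x * g x := by
    rw [setIntegral_eq_integral_of_forall_compl_eq_zero (s := Ω)
      (f := fun x => D i c x * g x)]
    · apply integral_congr_ae
      filter_upwards [hc.ae_diff] with x hx
      rw [hx.lineDeriv_eq_fderiv]
      by_cases hxS : x ∈ S
      · rw [(hfS x hxS).eq_of_nhds]; rfl
      · show D i c x * _ = _
        rw [hcs x hxS]; simp
    · intro x hx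
      rw [hcs x (fun h => hx (hSΩ h))]; simp
  have eR : ∫ x, lineDeriv ℝ f x (-e i) * c x = - ∫ x in Ω, c x * D i g x := by
    rw [setIntegral_eq_integral_of_forall_compl_eq_zero (s := Ω)
      (f := fun x => c x * D i g x), ← integral_neg]
    · congr 1; ext x
      rw [((hfd.differentiable one_ne_zero) x).lineDeriv_eq_fderiv]
      by_cases hxS : x ∈ S
      · rw [(hfS x hxS).fderiv_eq]; simp [D]; ring
      · rw [hcS x hxS]; simp
    · intro x hx
      rw [hcS x (fun h => hx (hSΩ h))]; simp
  rw [← eL, ← eR, key]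

end

section

def wd (Ω : Set E2) (δ : ℝ) (x : E2) : ℝ := deriv th (dd Ω x / δ) / δ

lemma wd_nonneg (Ω : Set E2) {δ : ℝ} (hδ : 0 < δ) (x : E2) : 0 ≤ wd Ω δ x :=
  div_nonneg (dth_nonneg _) hδ.le

lemma wd_le (Ω : Set E2) {δ : ℝ} (hδ : 0 < δ) (x : E2) : wd Ω δ x ≤ thA / δ := by
  unfold wd; gcongr; exact dth_le _

lemma wd_zero (Ω : Set E2) {δ : ℝ} (hδ : 0 < δ) {x : E2} (h : 2 * δ < dd Ω x) : wd Ω δ x = 0 := by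
  unfold wd; rw [dth_zero_right, zero_div]; rwa [lt_div_iff₀ hδ]

lemma wd_zero_left (Ω : Set E2) {δ : ℝ} (hδ : 0 < δ) {x : E2} (h : dd Ω x < δ) : wd Ω δ x = 0 := by
  unfold wd; rw [dth_zero_left, zero_div]; rwa [div_lt_iff₀ hδ, one_mul]

lemma wd_cont (Ω : Set E2) (δ : ℝ) : Continuous (wd Ω δ) :=
  (dth_cont.comp ((dd_lp Ω).continuous.div_const δ)).div_const δ

lemma D_meas (i : Fin 2) (f : E2 → ℝ) : Measurable (D i f) := measurable_fderiv_apply_const ℝ f (e i)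

lemma Geo.vol_fin {Ω : Set E2} {r : ℝ} {ν : E2 → E2} (G : Geo Ω r ν) : volume Ω < ⊤ :=
  G.bd.measure_lt_top

lemma Geo.intOn {Ω : Set E2} {r : ℝ} {ν : E2 → E2} (G : Geo Ω r ν) {f : E2 → ℝ} {M : ℝ}
    (hm : AEStronglyMeasurable f (volume.restrict Ω)) (hb : ∀ x ∈ Ω, |f x| ≤ M) :
    IntegrableOn f Ω :=
  by
  have : IsFiniteMeasure (volume.restrict Ω) := ⟨by simpa using G.vol_fin⟩
  exact Integrable.of_bound hm M
    ((ae_restrict_iff' G.op.measurableSet).2 (Eventually.of_forall hb))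

/-- C¹ on Ω, continuous up to the boundary, bounded derivatives -/
structure Good (Ω : Set E2) (g : E2 → ℝ) : Prop where
  cd : ContDiffOn ℝ 1 g Ω
  ct : ContinuousOn g (closure Ω)
  dbd : ∀ i, ∃ M, ∀ x ∈ Ω, |D i g x| ≤ M

lemma Good.diff {Ω : Set E2} (hΩ : IsOpen Ω) {g : E2 → ℝ} (h : Good Ω g) {x : E2} (hx : x ∈ Ω) :
    DifferentiableAt ℝ g x :=
  (h.cd.contDiffAt (hΩ.mem_nhds hx)).differentiableAt one_ne_zero

lemma Geo.bdd {Ω : Set E2} {r : ℝ} {ν : E2 → E2} (G : Geo Ω r ν) {g : E2 → ℝ}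
    (h : ContinuousOn g (closure Ω)) : ∃ M, 0 ≤ M ∧ ∀ x ∈ closure Ω, |g x| ≤ M := by
  obtain ⟨M, hM⟩ := G.compact_cl.exists_bound_of_continuousOn h
  exact ⟨max M 0, le_max_right _ _, fun x hx => (hM x hx).trans (le_max_left _ _)⟩

lemma Geo.intOn_ct {Ω : Set E2} {r : ℝ} {ν : E2 → E2} (G : Geo Ω r ν) {g : E2 → ℝ}
    (h : ContinuousOn g (closure Ω)) : IntegrableOn g Ω := by
  obtain ⟨M, -, hM⟩ := G.bdd h
  exact G.intOn ((h.mono subset_closure).aestronglyMeasurable G.op.measurableSet)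
    (fun x hx => hM x (subset_closure hx))

lemma D_add {f g : E2 → ℝ} {x : E2} (i : Fin 2) (hf : DifferentiableAt ℝ f x)
    (hg : DifferentiableAt ℝ g x) : D i (fun y => f y + g y) x = D i f x + D i g x := by
  unfold D; rw [fderiv_fun_add hf hg]; simp

lemma D_sub {f g : E2 → ℝ} {x : E2} (i : Fin 2) (hf : DifferentiableAt ℝ f x)
    (hg : DifferentiableAt ℝ g x) : D i (fun y => f y - g y) x = D i f x - D i g x := by
  unfold D; rw [fderiv_fun_sub hf hg]; simp

lemma D_mul {f g : E2 → ℝ} {x : E2} (i : Fin 2) (hf : DifferentiableAt ℝ f x)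
    (hg : DifferentiableAt ℝ g x) :
    D i (fun y => f y * g y) x = D i f x * g x + f x * D i g x := by
  unfold D; rw [fderiv_fun_mul hf hg]; simp; ring

lemma D_const (i : Fin 2) (c : ℝ) (x : E2) : D i (fun _ => c) x = 0 := by
  unfold D; simp

section
variable {Ω : Set E2} {r : ℝ} {ν : E2 → E2} {f g : E2 → ℝ}

lemma Good.const (c : ℝ) : Good Ω (fun _ => c) :=
  ⟨contDiffOn_const, continuousOn_const, fun i => ⟨0, fun x _ => by rw [D_const]; simp⟩⟩

lemma Good.add (G : Geo Ω r ν) (hf : Good Ω f) (hg : Good Ω g) : Good Ω (fun x => f x + g x) := by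
  refine ⟨hf.cd.add hg.cd, hf.ct.add hg.ct, fun i => ?_⟩
  obtain ⟨M, hM⟩ := hf.dbd i
  obtain ⟨N, hN⟩ := hg.dbd i
  refine ⟨M + N, fun x hx => ?_⟩
  rw [D_add i (hf.diff G.op hx) (hg.diff G.op hx)]
  exact (abs_add_le _ _).trans (add_le_add (hM x hx) (hN x hx))

lemma Good.mul (G : Geo Ω r ν) (hf : Good Ω f) (hg : Good Ω g) : Good Ω (fun x => f x * g x) := by
  refine ⟨hf.cd.mul hg.cd, hf.ct.mul hg.ct, fun i => ?_⟩
  obtain ⟨M, hM⟩ := hf.dbd i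
  obtain ⟨N, hN⟩ := hg.dbd i
  obtain ⟨M', _, hM'⟩ := G.bdd hf.ct
  obtain ⟨N', _, hN'⟩ := G.bdd hg.ct
  refine ⟨M * N' + M' * N, fun x hx => ?_⟩
  rw [D_mul i (hf.diff G.op hx) (hg.diff G.op hx)]
  have hx' := subset_closure hx
  refine (abs_add_le _ _).trans ?_
  rw [abs_mul, abs_mul]
  have h1 := hM x hx; have h2 := hN x hx; have h3 := hM' x hx'; have h4 := hN' x hx'
  have h5 := (abs_nonneg _).trans h1
  gcongr

lemma Good.smul (G : Geo Ω r ν) (c : ℝ) (hf : Good Ω f) : Good Ω (fun x => c * f x) :=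
  (Good.const c).mul G hf

lemma Good.sub (G : Geo Ω r ν) (hf : Good Ω f) (hg : Good Ω g) : Good Ω (fun x => f x - g x) := by
  have := hf.add G (hg.smul G (-1))
  simpa [sub_eq_add_neg] using this

lemma Geo.int_wd (G : Geo Ω r ν) (δ : ℝ) (h : ContinuousOn f (closure Ω)) :
    IntegrableOn (fun x => wd Ω δ x * f x) Ω :=
  G.intOn_ct ((wd_cont Ω δ).continuousOn.mul h)

/-- weak flux relation -/
structure Fx (Ω : Set E2) (h h' : E2 → ℝ) : Prop where
  int' : IntegrableOn h' Ω
  ct : ContinuousOn h (closure Ω)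
  lim : Tendsto (fun δ => ∫ x in Ω, wd Ω δ x * h x) (𝓝[>] (0:ℝ)) (𝓝 (∫ x in Ω, h' x))

lemma Fx.add (G : Geo Ω r ν)
    {h h' k k' : E2 → ℝ} (H1 : Fx Ω h h') (H2 : Fx Ω k k') :
    Fx Ω (fun x => h x + k x) (fun x => h' x + k' x) := by
  refine ⟨H1.int'.add H2.int', H1.ct.add H2.ct, ?_⟩
  rw [integral_add H1.int' H2.int']
  refine (H1.lim.add H2.lim).congr fun δ => ?_
  rw [← integral_add (G.int_wd δ H1.ct) (G.int_wd δ H2.ct)]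
  congr 1; ext x; ring

lemma Fx.smul {h h' : E2 → ℝ} (c : ℝ) (H1 : Fx Ω h h') :
    Fx Ω (fun x => c * h x) (fun x => c * h' x) := by
  refine ⟨H1.int'.const_mul c, continuousOn_const.mul H1.ct, ?_⟩
  rw [integral_const_mul]
  refine (H1.lim.const_mul c).congr fun δ => ?_
  rw [← integral_const_mul]
  congr 1; ext x; ring

lemma Fx.of (G : Geo Ω r ν) {n : Fin 2 → E2 → ℝ} (hn : ∀ i, Lp (1/r) (n i))
    (hnf : ∀ i, ∀ x ∈ frontier Ω, n i x = ν x i) {K B : ℝ} {b : E2 → ℝ} (hb : Lp K b)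
    (hB : ∀ x, |b x| ≤ B) (hg : Good Ω g) (i : Fin 2) :
    Fx Ω (fun x => b x * g x * n i x) (fun x => D i b x * g x + b x * D i g x) := by
  have hr := G.rpos
  have hB0 : 0 ≤ B := (abs_nonneg _).trans (hB 0)
  obtain ⟨M, hM0, hM⟩ := G.bdd hg.ct
  obtain ⟨N, hN⟩ := hg.dbd i
  have hgm : AEStronglyMeasurable g (volume.restrict Ω) :=
    (hg.ct.mono subset_closure).aestronglyMeasurable G.op.measurableSet
  have hbm : AEStronglyMeasurable b (volume.restrict Ω) := hb.continuous.aestronglyMeasurable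
  have hDb : AEStronglyMeasurable (D i b) (volume.restrict Ω) := (D_meas i b).aestronglyMeasurable
  have hDg : AEStronglyMeasurable (D i g) (volume.restrict Ω) := (D_meas i g).aestronglyMeasurable
  have hDd : AEStronglyMeasurable (D i (dd Ω)) (volume.restrict Ω) :=
    (D_meas i _).aestronglyMeasurable
  have hnm : AEStronglyMeasurable (n i) (volume.restrict Ω) :=
    (hn i).continuous.aestronglyMeasurable
  have hqb : ∀ x ∈ Ω, |D i b x * g x + b x * D i g x| ≤ K * M + B * N := by
    intro x hx
    refine (abs_add_le _ _).trans ?_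
    rw [abs_mul, abs_mul]
    have h1 := hb.D_le i x; have h2 := hM x (subset_closure hx); have h3 := hB x
    have h4 := hN x hx; have h5 := hb.nonneg
    gcongr
  have hqm : AEStronglyMeasurable (fun x => D i b x * g x + b x * D i g x) (volume.restrict Ω) :=
    (hDb.mul hgm).add (hbm.mul hDg)
  refine ⟨G.intOn hqm hqb, (hb.continuous.continuousOn.mul hg.ct).mul (hn i).continuous.continuousOn, ?_⟩
  have hwm : ∀ δ, AEStronglyMeasurable (wd Ω δ) (volume.restrict Ω) :=
    fun δ => (wd_cont Ω δ).aestronglyMeasurable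
  have hηc : ∀ δ, Continuous (fun x => th (dd Ω x / δ)) := fun δ =>
    th_contDiff.continuous.comp ((dd_lp Ω).continuous.div_const δ)
  -- the exact identity
  have key : ∀ δ > 0, ∫ x in Ω, wd Ω δ x * (b x * g x * n i x) =
      ∫ x in Ω, (wd Ω δ x * (D i (dd Ω) x + n i x) * (b x * g x) +
        th (dd Ω x / δ) * (D i b x * g x + b x * D i g x)) := by
    intro δ hδ
    have hηl : Lp (thA * (1/δ)) (fun x => th (dd Ω x / δ)) := by
      have h1 : Lp (1/δ) (fun x => dd Ω x / δ) := by
        intro x y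
        rw [← sub_div, abs_div, abs_of_pos hδ]
        have := dd_lp Ω x y
        rw [one_mul] at this
        calc _ ≤ ‖x - y‖ / δ := by gcongr
          _ = _ := by ring
      exact h1.comp (zero_le_one.trans thA_one) th_lip
    have hcl := hηl.mul hb (A := 1) (B := B)
      (fun x => by rw [abs_of_nonneg (th_nonneg _)]; exact th_le_one _) hB
    set S := {x : E2 | δ ≤ dd Ω x} with hS
    have hSΩ : S ⊆ Ω := by
      intro x hx
      by_contra h
      have : δ ≤ dd Ω x := hx
      rw [dd_out h] at this; linarith
    have hSc : IsCompact S := by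
      apply Metric.isCompact_of_isClosed_isBounded
      · exact isClosed_le continuous_const (dd_lp Ω).continuous
      · exact G.bd.subset hSΩ
    have h1 := ibp G.op hSc hSΩ hcl (fun x hx => by
      have : dd Ω x < δ := not_le.1 hx
      rw [th_zero, zero_mul]
      rw [div_le_one hδ]; exact this.le) hg.cd i
    have h2 : ∫ x in Ω, D i (fun x => th (dd Ω x / δ) * b x) x * g x =
        ∫ x in Ω, (wd Ω δ x * D i (dd Ω) x * (b x * g x) + th (dd Ω x / δ) * (D i b x * g x)) := by
      apply setIntegral_congr_ae G.op.measurableSet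
      filter_upwards [G.ae_dd hn hnf, hb.ae_diff] with x hx hbx hxO
      obtain ⟨hd, -, -⟩ := hx hxO
      have h3 : HasFDerivAt (fun x => th (dd Ω x / δ))
          ((deriv th (dd Ω x / δ)) • ((δ⁻¹ : ℝ) • fderiv ℝ (dd Ω) x)) x := by
        have := (th_hasDeriv (dd Ω x / δ)).comp_hasFDerivAt x
          (f := fun x => dd Ω x / δ) (f' := (δ⁻¹ : ℝ) • fderiv ℝ (dd Ω) x) (by
            have h0 := hd.hasFDerivAt.const_smul (δ⁻¹ : ℝ)
            refine h0.congr_of_eventuallyEq (Eventually.of_forall fun y => ?_)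
            simp; ring)
        exact this
      rw [D_mul i h3.differentiableAt hbx]
      have h4 : D i (fun x => th (dd Ω x / δ)) x = wd Ω δ x * D i (dd Ω) x := by
        unfold D wd; rw [h3.fderiv]; simp; ring
      rw [h4]; ring
    have bw : ∀ x, |wd Ω δ x| ≤ thA / δ := fun x => by
      rw [abs_of_nonneg (wd_nonneg Ω hδ x)]; exact wd_le Ω hδ x
    have bη : ∀ x, |th (dd Ω x / δ)| ≤ 1 := fun x => by
      rw [abs_of_nonneg (th_nonneg _)]; exact th_le_one _
    have i1 : IntegrableOn (fun x => wd Ω δ x * D i (dd Ω) x * (b x * g x)) Ω := by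
      refine G.intOn (M := thA / δ * 1 * (B * M)) (((hwm δ).mul hDd).mul (hbm.mul hgm)) ?_
      intro x hx
      rw [abs_mul, abs_mul, abs_mul]
      have := bw x; have := (dd_lp Ω).D_le i x; have := hB x; have := hM x (subset_closure hx)
      have := (abs_nonneg _).trans (bw x)
      gcongr
    have i2 : IntegrableOn (fun x => th (dd Ω x / δ) * (D i b x * g x)) Ω := by
      refine G.intOn (M := 1 * (K * M)) ((hηc δ).aestronglyMeasurable.mul (hDb.mul hgm)) ?_
      intro x hx
      rw [abs_mul, abs_mul]
      have := bη x; have := hb.D_le i x; have := hM x (subset_closure hx); have := hb.nonneg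
      gcongr
    have i3 : IntegrableOn (fun x => th (dd Ω x / δ) * b x * D i g x) Ω := by
      refine G.intOn (M := 1 * B * N) (((hηc δ).aestronglyMeasurable.mul hbm).mul hDg) ?_
      intro x hx
      rw [abs_mul, abs_mul]
      have := bη x; have := hB x; have := hN x hx
      gcongr
    have i4 : IntegrableOn (fun x => wd Ω δ x * (b x * g x * n i x)) Ω :=
      G.int_wd δ ((hb.continuous.continuousOn.mul hg.ct).mul (hn i).continuous.continuousOn)
    rw [h2, integral_add i1 i2] at h1
    have h5 : ∫ x in Ω, (wd Ω δ x * (D i (dd Ω) x + n i x) * (b x * g x) +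
        th (dd Ω x / δ) * (D i b x * g x + b x * D i g x)) =
        ∫ x in Ω, ((wd Ω δ x * D i (dd Ω) x * (b x * g x) + wd Ω δ x * (b x * g x * n i x)) +
         (th (dd Ω x / δ) * (D i b x * g x) + th (dd Ω x / δ) * b x * D i g x)) := by
      congr 1; ext x; ring
    have h6 := integral_add (i1.add i4) (i2.add i3)
    simp only [Pi.add_apply] at h6
    rw [h5, h6, integral_add i1 i4, integral_add i2 i3]
    linarith
  have hmem : Ioi (0:ℝ) ∈ 𝓝[>] (0:ℝ) := self_mem_nhdsWithin
  have : Tendsto (fun δ => ∫ x in Ω, (wd Ω δ x * (D i (dd Ω) x + n i x) * (b x * g x) +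
        th (dd Ω x / δ) * (D i b x * g x + b x * D i g x))) (𝓝[>] (0:ℝ))
        (𝓝 (∫ x in Ω, (D i b x * g x + b x * D i g x))) := by
    apply tendsto_integral_filter_of_dominated_convergence
      (bound := fun _ => (thA * (2 / r)) * (B * M) + (K * M + B * N))
    · exact Eventually.of_forall fun δ =>
        (((hwm δ).mul (hDd.add hnm)).mul (hbm.mul hgm)).add
          ((hηc δ).aestronglyMeasurable.mul hqm)
    · filter_upwards [hmem] with δ hδ
      have hδ : 0 < δ := hδ
      rw [ae_restrict_iff' G.op.measurableSet]
      filter_upwards [G.ae_dd hn hnf] with x hx hxO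
      obtain ⟨-, -, h3⟩ := hx hxO
      rw [Real.norm_eq_abs]
      refine (abs_add_le _ _).trans (add_le_add ?_ ?_)
      · rw [abs_mul, abs_mul (b x)]
        have h4 := hB x; have h5 := hM x (subset_closure hxO)
        have hA0 := zero_le_one.trans thA_one
        have : |wd Ω δ x * (D i (dd Ω) x + n i x)| ≤ thA * (2 / r) := by
          by_cases hc : 2 * δ < dd Ω x
          · rw [wd_zero Ω hδ hc]; simp; positivity
          · rw [abs_mul, abs_of_nonneg (wd_nonneg Ω hδ x)]
            calc _ ≤ thA / δ * (2 * δ / r) := by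
                  apply mul_le_mul (wd_le Ω hδ x) _ (abs_nonneg _) (by positivity)
                  refine (h3 i).trans ?_
                  gcongr; exact not_lt.1 hc
              _ = _ := by field_simp
        gcongr
      · rw [abs_mul, abs_of_nonneg (th_nonneg _)]
        calc _ ≤ 1 * (K * M + B * N) := by
              apply mul_le_mul (th_le_one _) (hqb x hxO) (abs_nonneg _) zero_le_one
          _ = _ := one_mul _
    · have : IsFiniteMeasure (volume.restrict Ω) := ⟨by simpa using G.vol_fin⟩
      exact integrable_const _
    · rw [ae_restrict_iff' G.op.measurableSet]
      refine Eventually.of_forall fun x hx => ?_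
      have hd := G.dd_pos hx
      apply tendsto_const_nhds.congr'
      have : Ioo (0:ℝ) (dd Ω x / 2) ∈ 𝓝[>] (0:ℝ) := Ioo_mem_nhdsGT (by positivity)
      filter_upwards [this] with δ hδ
      rw [wd_zero Ω hδ.1 (by linarith [hδ.2]), th_one]
      · simp
      · rw [le_div_iff₀ hδ.1]; linarith [hδ.2]
  refine this.congr' ?_
  filter_upwards [hmem] with δ hδ
  exact (key δ hδ).symm

lemma Geo.near (G : Geo Ω r ν) {Φ : E2 → ℝ} (h : ContinuousOn Φ (closure Ω))
    (hneg : ∀ x ∈ frontier Ω, Φ x < 0) : ∃ δ0 > 0, ∀ x ∈ Ω, dd Ω x < δ0 → Φ x < 0 := by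
  set S := closure Ω ∩ Φ ⁻¹' (Ici 0) with hS
  have hSc : IsCompact S :=
    G.compact_cl.of_isClosed_subset (h.preimage_isClosed_of_isClosed isClosed_closure isClosed_Ici)
      inter_subset_left
  have hSΩ : S ⊆ Ω := by
    intro x hx
    by_contra hxO
    have : x ∈ frontier Ω := by rw [G.op.frontier_eq]; exact ⟨hx.1, hxO⟩
    have h1 := hneg x this
    have h2 : 0 ≤ Φ x := hx.2
    linarith
  rcases S.eq_empty_or_nonempty with he | hne
  · refine ⟨1, one_pos, fun x hx _ => ?_⟩
    by_contra hc
    have : x ∈ S := ⟨subset_closure hx, not_lt.1 hc⟩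
    rw [he] at this; exact this
  · obtain ⟨x0, hx0, hmin⟩ := hSc.exists_isMinOn hne (dd_lp Ω).continuous.continuousOn
    refine ⟨dd Ω x0, G.dd_pos (hSΩ hx0), fun x hx hlt => ?_⟩
    by_contra hc
    have : x ∈ S := ⟨subset_closure hx, not_lt.1 hc⟩
    have := hmin this
    exact absurd hlt (not_lt.2 this)

/-- comparison of boundary layer integrals -/
lemma Geo.wd_compare (G : Geo Ω r ν) {Φ Ψ : E2 → ℝ} (h : ContinuousOn Φ (closure Ω))
    (h2 : ContinuousOn Ψ (closure Ω))
    (hneg : ∀ x ∈ frontier Ω, Φ x < Ψ x) :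
    ∀ᶠ δ in 𝓝[>] (0:ℝ), ∫ x in Ω, wd Ω δ x * Φ x ≤ ∫ x in Ω, wd Ω δ x * Ψ x := by
  obtain ⟨δ0, hδ0, H⟩ := G.near (h.sub h2) (fun x hx => sub_neg.2 (hneg x hx))
  have : Ioo (0:ℝ) (δ0 / 2) ∈ 𝓝[>] (0:ℝ) := Ioo_mem_nhdsGT (by positivity)
  filter_upwards [this] with δ hδ
  apply setIntegral_mono_on (G.int_wd δ h) (G.int_wd δ h2) G.op.measurableSet
  intro x hx
  by_cases hc : 2 * δ < dd Ω x
  · rw [wd_zero Ω hδ.1 hc]; simp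
  · apply mul_le_mul_of_nonneg_left _ (wd_nonneg Ω hδ.1 x)
    exact (sub_neg.1 (H x hx (by linarith [hδ.2]))).le

end

end

section

section
variable {Ω : Set E2} {r : ℝ} {ν : E2 → E2}

lemma Geo.cross (G : Geo Ω r ν) {y : E2} (hy : y ∈ frontier Ω) {t : ℝ} (ht : |t| < r) :
    ∃ s : ℝ, |s| ≤ t ^ 2 / r ∧ y + t • rot (ν y) + s • ν y ∈ frontier Ω := by
  have hr := G.rpos
  by_cases h0 : t = 0
  · exact ⟨0, by simp [h0], by simpa [h0] using hy⟩
  set a := t ^ 2 / r with ha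
  have ha0 : 0 < a := by positivity
  have hu : (ν y) 0 ^ 2 + (ν y) 1 ^ 2 = 1 := by rw [← norm_sq_two, G.unit y hy]; norm_num
  have har : a * r = t ^ 2 := by rw [ha]; field_simp
  have hat : a ^ 2 < t ^ 2 := by
    have h1 : a * |t| < a * r := mul_lt_mul_of_pos_left ht ha0
    have h2 : 0 < |t| := abs_pos.2 h0
    have h3 : a < |t| := by
      by_contra hc
      have := mul_le_mul_of_nonneg_right (not_lt.1 hc) h2.le
      have h4 : |t| * |t| = t ^ 2 := by rw [← sq, sq_abs]
      linarith
    rw [← sq_abs t]; gcongr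
  have hb : y + t • rot (ν y) + (-a) • ν y ∈ Ω := by
    apply G.inn y hy
    rw [mem_ball, dist_eq_norm]
    apply lt_of_pow_lt_pow_left₀ 2 hr.le
    rw [norm_sq_two]
    simp [rot_0, rot_1]
    nlinarith
  have htp : y + t • rot (ν y) + a • ν y ∈ Ωᶜ := by
    apply G.out y hy
    rw [mem_ball, dist_eq_norm]
    apply lt_of_pow_lt_pow_left₀ 2 hr.le
    rw [norm_sq_two]
    simp [rot_0, rot_1]
    nlinarith
  by_contra hcon
  push Not at hcon
  set f : ℝ → E2 := fun s => y + t • rot (ν y) + s • ν y with hf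
  have hfc : Continuous f := by fun_prop
  have hI : IsPreconnected (f '' Icc (-a) a) := isPreconnected_Icc.image f hfc.continuousOn
  have hnf : ∀ z ∈ f '' Icc (-a) a, z ∉ frontier Ω := by
    rintro z ⟨s, hs, rfl⟩
    exact hcon s (abs_le.2 hs)
  have hin : f (-a) ∈ f '' Icc (-a) a := ⟨-a, ⟨le_rfl, by linarith⟩, rfl⟩
  have hout : f a ∈ f '' Icc (-a) a := ⟨a, ⟨by linarith, le_rfl⟩, rfl⟩
  have key : ∀ z ∈ f '' Icc (-a) a, z ∉ Ω → z ∉ closure Ω := by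
    intro z hz h1 h2
    exact hnf z hz (by rw [G.op.frontier_eq]; exact ⟨h2, h1⟩)
  obtain ⟨z, -, h1, h2⟩ := hI Ω (closure Ω)ᶜ G.op isClosed_closure.isOpen_compl
    (fun z hz => by
      by_cases h : z ∈ Ω
      · exact Or.inl h
      · exact Or.inr (key z hz h))
    ⟨f (-a), hin, hb⟩ ⟨f a, hout, key _ hout htp⟩
  exact h2 (subset_closure h1)

lemma proj_lip (y v : E2) (hv : ‖v‖ = 1) : LipschitzWith 1 (fun z : E2 => ⟪z - y, v⟫) := by
  apply LipschitzWith.of_dist_le_mul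
  intro a b
  rw [Real.dist_eq, ← inner_sub_left, dist_eq_norm]
  have : a - y - (b - y) = a - b := by abel
  rw [this]
  have := abs_real_inner_le_norm (a - b) v
  rw [hv, mul_one] at this
  simpa using this

lemma norm_rot (v : E2) : ‖rot v‖ = ‖v‖ := by
  have : ‖rot v‖ ^ 2 = ‖v‖ ^ 2 := by rw [norm_sq_two, norm_sq_two, rot_0, rot_1]; ring
  exact (sq_eq_sq₀ (norm_nonneg _) (norm_nonneg _)).1 this

lemma Geo.density (G : Geo Ω r ν) {y : E2} (hy : y ∈ frontier Ω) {ρ : ℝ} (h0 : 0 < ρ)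
    (hρ : ρ ≤ r) :
    ENNReal.ofReal (2 * ρ) ≤ μH[1] (frontier Ω ∩ closedBall y (2 * ρ)) := by
  have hr := G.rpos
  have hnr : ‖rot (ν y)‖ = 1 := by rw [norm_rot, G.unit y hy]
  have hu : (ν y) 0 ^ 2 + (ν y) 1 ^ 2 = 1 := by rw [← norm_sq_two, G.unit y hy]; norm_num
  have h1 := (proj_lip y (rot (ν y)) hnr).hausdorffMeasure_image_le (d := 1) zero_le_one
    (frontier Ω ∩ closedBall y (2 * ρ))
  have h2 : Ioo (-ρ) ρ ⊆ (fun z : E2 => ⟪z - y, rot (ν y)⟫) ''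
      (frontier Ω ∩ closedBall y (2 * ρ)) := by
    intro t ht
    have ht' : |t| < ρ := abs_lt.2 ht
    obtain ⟨s, hs, hz⟩ := G.cross hy (ht'.trans_le hρ)
    refine ⟨_, ⟨hz, ?_⟩, ?_⟩
    · rw [mem_closedBall, dist_eq_norm]
      have : y + t • rot (ν y) + s • ν y - y = t • rot (ν y) + s • ν y := by abel
      rw [this]
      refine (norm_add_le _ _).trans ?_
      rw [norm_smul, norm_smul, hnr, G.unit y hy, mul_one, mul_one, Real.norm_eq_abs,
        Real.norm_eq_abs]
      have : t ^ 2 / r ≤ ρ := by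
        rw [div_le_iff₀ hr, ← sq_abs]
        have := abs_nonneg t
        nlinarith
      linarith
    · simp only []
      rw [inner_two]
      simp [rot_0, rot_1]
      linear_combination t * hu
  have h3 := measure_mono (μ := (μH[1] : Measure ℝ)) h2
  rw [hausdorffMeasure_real, Real.volume_Ioo] at h3
  rw [hausdorffMeasure_real] at h1
  simp only [ENNReal.coe_one, ENNReal.one_rpow, one_mul] at h1
  have : ρ - -ρ = 2 * ρ := by ring
  rw [this] at h3
  exact h3.trans h1

lemma Geo.fr_quad (G : Geo Ω r ν) {x y : E2} (hx : x ∈ frontier Ω) (hy : y ∈ frontier Ω) :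
    |⟪x - y, ν x⟫| * (2 * r) ≤ ‖x - y‖ ^ 2 := by
  have hr := G.rpos
  have hu : (ν x) 0 ^ 2 + (ν x) 1 ^ 2 = 1 := by rw [← norm_sq_two, G.unit x hx]; norm_num
  have h1 : y ∉ ball (x - r • ν x) r := fun h => not_mem_of_frontier G.op hy (G.inn x hx h)
  have h2 : y ∉ ball (x + r • ν x) r := by
    intro h
    have hcl : y ∈ closure Ω := frontier_subset_closure hy
    obtain ⟨z, hz, hzO⟩ := mem_closure_iff.1 hcl _ isOpen_ball h
    exact G.out x hx hz hzO
  rw [mem_ball, dist_eq_norm, not_lt] at h1 h2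
  have h1' := pow_le_pow_left₀ hr.le h1 2
  have h2' := pow_le_pow_left₀ hr.le h2 2
  rw [norm_sq_two] at h1' h2' ⊢
  rw [inner_two]
  simp at h1' h2' ⊢
  rw [← abs_of_pos (show (0:ℝ) < 2 * r by linarith), ← abs_mul, abs_le]
  constructor <;> nlinarith

lemma Geo.fr_fin (G : Geo Ω r ν) : μH[1] (frontier Ω) < ⊤ := by
  have hr := G.rpos
  apply G.compact_fr.measure_lt_top_of_nhdsWithin
  intro y hy
  have hnr : ‖rot (ν y)‖ = 1 := by rw [norm_rot, G.unit y hy]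
  refine ⟨frontier Ω ∩ ball y (r/4), inter_mem_nhdsWithin _ (ball_mem_nhds y (by positivity)), ?_⟩
  set s := frontier Ω ∩ ball y (r/4) with hs
  set f : s → ℝ := fun z => ⟪(z : E2) - y, rot (ν y)⟫ with hf
  have hanti : AntilipschitzWith 2 f := by
    apply AntilipschitzWith.of_le_mul_dist
    rintro ⟨a, ha, ha'⟩ ⟨b, hb, hb'⟩
    rw [Subtype.dist_eq, Real.dist_eq]
    simp only [hf]
    rw [← inner_sub_left, dist_eq_norm]
    have e1 : a - y - (b - y) = a - b := by abel
    rw [e1]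
    rw [mem_ball, dist_eq_norm] at ha' hb'
    have hab : ‖a - b‖ ≤ r / 2 := by
      have : a - b = (a - y) - (b - y) := by abel
      rw [this]
      exact (norm_sub_le _ _).trans (by linarith)
    have q := G.fr_quad ha hb
    have l := G.lip ha hy
    have hn := norm_nonneg (a - b)
    have h1 : |⟪a - b, ν a⟫| ≤ ‖a - b‖ / 4 := by
      have : |⟪a - b, ν a⟫| * (2 * r) ≤ (‖a - b‖ / 4) * (2 * r) := by
        refine q.trans ?_; nlinarith
      exact le_of_mul_le_mul_right this (by positivity)
    have h2 : |⟪a - b, ν a - ν y⟫| ≤ ‖a - b‖ / 4 := by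
      have l2 : ‖ν a - ν y‖ ≤ 1 / 4 := by
        refine l.trans ?_
        rw [div_le_iff₀ hr]; linarith
      calc _ ≤ ‖a - b‖ * ‖ν a - ν y‖ := abs_real_inner_le_norm _ _
        _ ≤ ‖a - b‖ * (1/4) := by gcongr
        _ = _ := by ring
    have h3 : |⟪a - b, ν y⟫| ≤ ‖a - b‖ / 2 := by
      have : ⟪a - b, ν y⟫ = ⟪a - b, ν a⟫ - ⟪a - b, ν a - ν y⟫ := by rw [inner_sub_right]; ring
      rw [this]
      exact (abs_sub _ _).trans (by linarith)
    have hu : (ν y) 0 ^ 2 + (ν y) 1 ^ 2 = 1 := by rw [← norm_sq_two, G.unit y hy]; norm_num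
    have h4 : ‖a - b‖ ^ 2 = ⟪a - b, ν y⟫ ^ 2 + ⟪a - b, rot (ν y)⟫ ^ 2 := by
      rw [norm_sq_two, inner_two, inner_two, rot_0, rot_1]
      linear_combination (-((a - b) 0 ^ 2 + (a - b) 1 ^ 2)) * hu
    have h5 : ⟪a - b, ν y⟫ ^ 2 ≤ (‖a - b‖ / 2) ^ 2 := by
      rw [← sq_abs]; gcongr
    have h6 : ‖a - b‖ ^ 2 ≤ (2 * |⟪a - b, rot (ν y)⟫|) ^ 2 := by
      rw [mul_pow, sq_abs]; nlinarith
    have := (sq_le_sq₀ hn (by positivity)).1 h6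
    simpa using this
  have h1 := hanti.le_hausdorffMeasure_image (d := 1) zero_le_one univ
  have h2 : μH[1] (univ : Set s) = μH[1] s := by
    have := (isometry_subtype_coe (s := s)).hausdorffMeasure_image (d := 1) (Or.inl zero_le_one) univ
    rw [← this]; simp
  rw [h2] at h1
  refine h1.trans_lt ?_
  apply ENNReal.mul_lt_top
  · simp
  · rw [hausdorffMeasure_real]
    apply Bornology.IsBounded.measure_lt_top
    refine (isBounded_Icc (-(r/4)) (r/4)).subset ?_
    rintro _ ⟨⟨a, ha, ha'⟩, -, rfl⟩
    rw [mem_ball, dist_eq_norm] at ha'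
    simp only [hf]
    have := abs_real_inner_le_norm (a - y) (rot (ν y))
    rw [hnr, mul_one] at this
    exact mem_Icc.2 (abs_le.1 (this.trans ha'.le))

end

end

section

def CH : ℝ := 8 * Real.pi * thA

lemma CH_pos : 0 < CH := by
  have := thA_one
  have := Real.pi_pos
  unfold CH; positivity

section
variable {Ω : Set E2} {r : ℝ} {ν : E2 → E2}

lemma Geo.layer (G : Geo Ω r ν) {K : E2 → ℝ} (hK : Continuous K) (hK0 : ∀ x, 0 ≤ K x)
    {ε : ℝ} (hε : 0 < ε) :
    ∀ᶠ δ in 𝓝[>] (0:ℝ), ∫ x in Ω, wd Ω δ x * K x ≤ CH * (∫ x in frontier Ω, K x ∂μH[1]) + ε := by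
  have hr := G.rpos
  have hA : (0:ℝ) < thA := zero_lt_one.trans_le thA_one
  have hπ := Real.pi_pos
  set μ : Measure E2 := (μH[1] : Measure E2).restrict (frontier Ω) with hμ
  have hfin : IsFiniteMeasure μ := ⟨by simpa [hμ] using G.fr_fin⟩
  set m : ℝ := μ.real univ with hm
  have hm0 : 0 ≤ m := measureReal_nonneg
  set ε' : ℝ := ε / (CH * (m + 1)) with hε'
  have hCH := CH_pos
  have hε'0 : 0 < ε' := by positivity
  have huc := G.compact_cl.uniformContinuousOn_of_continuous hK.continuousOn
  rw [Metric.uniformContinuousOn_iff] at huc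
  obtain ⟨η, hη, Hη⟩ := huc ε' hε'0
  have : Ioo (0:ℝ) (min (η / 5) r) ∈ 𝓝[>] (0:ℝ) := Ioo_mem_nhdsGT (by positivity)
  filter_upwards [this] with δ hδ
  obtain ⟨hδ0, hδ1⟩ := hδ
  have hδη : 4 * δ < η := by linarith [hδ1.trans_le (min_le_left _ _)]
  have hδr : δ ≤ r := (hδ1.trans_le (min_le_right _ _)).le
  have hfr : MeasurableSet (frontier Ω) := isClosed_frontier.measurableSet
  have hKint : Integrable K μ := by
    obtain ⟨M, hM⟩ := G.compact_fr.exists_bound_of_continuousOn hK.continuousOn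
    exact Integrable.of_bound hK.aestronglyMeasurable M
      ((ae_restrict_iff' hfr).2 (Eventually.of_forall hM))
  set g : E2 → ℝ≥0∞ := fun y => ENNReal.ofReal (K y + ε') with hg
  have hgm : Measurable g := (hK.add continuous_const).measurable.ennreal_ofReal
  set I : E2 → E2 → ℝ≥0∞ := fun x y => (closedBall y (4 * δ)).indicator (fun _ => g y) x with hI
  have hIm : Measurable (Function.uncurry I) := by
    have : Function.uncurry I =
        ({q : E2 × E2 | dist q.1 q.2 ≤ 4 * δ}).indicator (fun q => g q.2) := by
      ext ⟨x, y⟩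
      simp only [Function.uncurry, hI, indicator, mem_closedBall]
      rfl
    rw [this]
    exact (hgm.comp measurable_snd).indicator
      (isClosed_le (continuous_fst.dist continuous_snd) continuous_const).measurableSet
  -- pointwise bound
  have pt : ∀ x ∈ Ω, ENNReal.ofReal (wd Ω δ x * K x) ≤
      ENNReal.ofReal (thA / (2 * δ ^ 2)) * ∫⁻ y, I x y ∂μ := by
    intro x hx
    by_cases hc : 2 * δ < dd Ω x
    · rw [wd_zero Ω hδ0 hc]; simp
    obtain ⟨y0, hy0, hxy, -⟩ := G.proj hx
    have hsub : closedBall y0 (2 * δ) ⊆ closedBall x (4 * δ) := by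
      apply closedBall_subset_closedBall'
      rw [dist_eq_norm, norm_sub_rev, hxy]; linarith
    have hd := (G.density hy0 hδ0 hδr).trans (measure_mono (inter_subset_inter_right _ hsub))
    have hball : ENNReal.ofReal (2 * δ) ≤ μ (closedBall x (4 * δ)) := by
      rw [hμ, Measure.restrict_apply isClosed_closedBall.measurableSet, inter_comm]; exact hd
    have hlow : ENNReal.ofReal (2 * δ) * ENNReal.ofReal (K x) ≤ ∫⁻ y, I x y ∂μ := by
      calc _ ≤ μ (closedBall x (4 * δ)) * ENNReal.ofReal (K x) := by gcongr
        _ = ∫⁻ y in closedBall x (4 * δ), ENNReal.ofReal (K x) ∂μ := by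
            rw [setLIntegral_const, mul_comm]
        _ = ∫⁻ y, (closedBall x (4 * δ)).indicator (fun _ => ENNReal.ofReal (K x)) y ∂μ := by
            rw [lintegral_indicator isClosed_closedBall.measurableSet]
        _ ≤ _ := by
            apply lintegral_mono_ae
            rw [hμ, ae_restrict_iff' hfr]
            refine Eventually.of_forall fun y hy => ?_
            by_cases hyB : y ∈ closedBall x (4 * δ)
            · have hxB : x ∈ closedBall y (4 * δ) := by rw [mem_closedBall_comm]; exact hyB
              simp only [hI]
              rw [indicator_of_mem hyB, indicator_of_mem hxB]
              apply ENNReal.ofReal_le_ofReal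
              have := Hη x (subset_closure hx) y (frontier_subset_closure hy)
                (lt_of_le_of_lt hxB hδη)
              rw [Real.dist_eq] at this
              linarith [le_abs_self (K x - K y)]
            · rw [indicator_of_notMem hyB]; exact zero_le
    have : ENNReal.ofReal (wd Ω δ x * K x) ≤
        ENNReal.ofReal (thA / (2 * δ ^ 2)) * (ENNReal.ofReal (2 * δ) * ENNReal.ofReal (K x)) := by
      rw [← ENNReal.ofReal_mul (by positivity), ← ENNReal.ofReal_mul (by positivity)]
      apply ENNReal.ofReal_le_ofReal
      calc _ ≤ thA / δ * K x := mul_le_mul_of_nonneg_right (wd_le Ω hδ0 x) (hK0 x)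
        _ = _ := by field_simp
    exact this.trans (by gcongr)
  have hvol : ∀ y, ∫⁻ x, I x y ≤ ENNReal.ofReal (16 * δ ^ 2 * Real.pi) * g y := by
    intro y
    simp only [hI]
    rw [lintegral_indicator isClosed_closedBall.measurableSet, setLIntegral_const,
      EuclideanSpace.volume_closedBall_fin_two, ← ENNReal.ofReal_pow (by positivity),
      ← ENNReal.ofReal_mul (by positivity), mul_comm]
    gcongr
    apply le_of_eq; ring
  have hgint : ∫⁻ y, g y ∂μ = ENNReal.ofReal (∫ y, K y ∂μ + ε' * m) := by
    have h1 := ofReal_integral_eq_lintegral_ofReal (hKint.add (integrable_const ε'))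
      (Eventually.of_forall fun y => add_nonneg (hK0 y) hε'0.le)
    simp only [Pi.add_apply] at h1
    rw [integral_add hKint (integrable_const _)] at h1
    simp only [hg]
    rw [← h1]
    simp [hm, mul_comm]
  have hKi0 : 0 ≤ ∫ y, K y ∂μ := integral_nonneg hK0
  have main : ∫⁻ x in Ω, ENNReal.ofReal (wd Ω δ x * K x) ≤
      ENNReal.ofReal (CH * (∫ y, K y ∂μ + ε' * m)) := by
    calc _ ≤ ∫⁻ x in Ω, ENNReal.ofReal (thA / (2 * δ ^ 2)) * ∫⁻ y, I x y ∂μ :=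
          setLIntegral_mono' G.op.measurableSet pt
      _ ≤ ∫⁻ x, ENNReal.ofReal (thA / (2 * δ ^ 2)) * ∫⁻ y, I x y ∂μ := setLIntegral_le_lintegral _ _
      _ = ENNReal.ofReal (thA / (2 * δ ^ 2)) * ∫⁻ x, ∫⁻ y, I x y ∂μ :=
          lintegral_const_mul' _ _ ENNReal.ofReal_ne_top
      _ = ENNReal.ofReal (thA / (2 * δ ^ 2)) * ∫⁻ y, ∫⁻ x, I x y ∂volume ∂μ := by
          rw [lintegral_lintegral_swap hIm.aemeasurable]
      _ ≤ ENNReal.ofReal (thA / (2 * δ ^ 2)) *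
          ∫⁻ y, ENNReal.ofReal (16 * δ ^ 2 * Real.pi) * g y ∂μ := by
          gcongr with y; exact hvol y
      _ = _ := by
          rw [lintegral_const_mul' _ _ ENNReal.ofReal_ne_top, hgint,
            ← ENNReal.ofReal_mul (by positivity), ← ENNReal.ofReal_mul (by positivity)]
          congr 1
          unfold CH
          field_simp; ring
  have hnn : ∀ x, 0 ≤ wd Ω δ x * K x := fun x => mul_nonneg (wd_nonneg Ω hδ0 x) (hK0 x)
  rw [integral_eq_lintegral_of_nonneg_ae (Eventually.of_forall hnn)
    ((wd_cont Ω δ).mul hK).aestronglyMeasurable]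
  refine (ENNReal.toReal_le_of_le_ofReal (by positivity) main).trans ?_
  rw [mul_add]
  gcongr
  rw [hε']
  have : CH * (ε / (CH * (m + 1)) * m) = ε * (m / (m + 1)) := by field_simp
  rw [this]
  have : m / (m + 1) ≤ 1 := by rw [div_le_one (by linarith)]; linarith
  nlinarith

end

end

section

/-- bilinear combination -/
def bil (c : ℝ) (f g : E2 → ℝ) (c' : ℝ) (h k : E2 → ℝ) (x : E2) : ℝ :=
  c * (f x * g x) + c' * (h x * k x)

section
variable {Ω : Set E2} {r : ℝ} {ν : E2 → E2}

lemma Good.bil (G : Geo Ω r ν) {f g h k : E2 → ℝ} (hf : Good Ω f) (hg : Good Ω g) (hh : Good Ω h)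
    (hk : Good Ω k) (c c' : ℝ) : Good Ω (bil c f g c' h k) :=
  ((hf.mul G hg).smul G c).add G ((hh.mul G hk).smul G c')

lemma D_bil (G : Geo Ω r ν) {f g h k : E2 → ℝ} (hf : Good Ω f) (hg : Good Ω g) (hh : Good Ω h)
    (hk : Good Ω k) (c c' : ℝ) (i : Fin 2) {x : E2} (hx : x ∈ Ω) :
    D i (bil c f g c' h k) x = c * (D i f x * g x + f x * D i g x) +
      c' * (D i h x * k x + h x * D i k x) := by
  have h1 := hf.diff G.op hx; have h2 := hg.diff G.op hx
  have h3 := hh.diff G.op hx; have h4 := hk.diff G.op hx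
  unfold StokesPaper.bil
  rw [D_add i ((differentiableAt_const c).fun_mul (h1.fun_mul h2))
    ((differentiableAt_const c').fun_mul (h3.fun_mul h4)),
    D_mul i (differentiableAt_const c) (h1.fun_mul h2),
    D_mul i (differentiableAt_const c') (h3.fun_mul h4),
    D_mul i h1 h2, D_mul i h3 h4, D_const, D_const]
  ring

lemma Fx.congr (hΩ : IsOpen Ω) {h h' k k' : E2 → ℝ} (H : Fx Ω h h') (h1 : ∀ x, h x = k x)
    (h2 : ∀ x ∈ Ω, h' x = k' x) : Fx Ω k k' := by
  obtain rfl : h = k := funext h1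
  refine ⟨H.int'.congr_fun h2 hΩ.measurableSet, H.ct, ?_⟩
  rw [← setIntegral_congr_fun hΩ.measurableSet h2]
  exact H.lim

lemma Fx.pair (G : Geo Ω r ν) {n : Fin 2 → E2 → ℝ} (hn : ∀ i, Lp (1/r) (n i))
    (hnf : ∀ i, ∀ x ∈ frontier Ω, n i x = ν x i) {K B : ℝ} {b : E2 → ℝ} (hb : Lp K b)
    (hB : ∀ x, |b x| ≤ B) {g0 g1 : E2 → ℝ} (h0 : Good Ω g0) (h1 : Good Ω g1) (q : E2 → ℝ)
    (hq : ∀ x ∈ Ω, D 0 g0 x + D 1 g1 x = q x) :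
    Fx Ω (fun x => b x * (g0 x * n 0 x + g1 x * n 1 x))
      (fun x => D 0 b x * g0 x + D 1 b x * g1 x + b x * q x) := by
  refine ((Fx.of G hn hnf hb hB h0 0).add G (Fx.of G hn hnf hb hB h1 1)).congr G.op ?_ ?_
  · intro x; ring
  · intro x hx; rw [← hq x hx]; ring

structure PDE (Ω : Set E2) (e1 e2 om : E2 → ℝ) (A B w : Fin 2 → E2 → ℝ) : Prop where
  ge1 : Good Ω e1
  ge2 : Good Ω e2
  gom : Good Ω om
  gA : ∀ i, Good Ω (A i)
  gB : ∀ i, Good Ω (B i)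
  gw : ∀ i, Good Ω (w i)
  dA : ∀ i, ∀ x ∈ Ω, D i e1 x = A i x
  dB : ∀ i, ∀ x ∈ Ω, D i e2 x = B i x
  dw : ∀ i, ∀ x ∈ Ω, D i om x = w i x
  r1 : ∀ x ∈ Ω, A 0 x + B 1 x = - (1/2) * w 1 x
  r2 : ∀ x ∈ Ω, B 0 x - A 1 x = (1/2) * w 0 x
  harm : ∀ x ∈ Ω, D 0 (w 0) x + D 1 (w 1) x = 0
  sA : ∀ x ∈ Ω, D 0 (A 1) x = D 1 (A 0) x
  sB : ∀ x ∈ Ω, D 0 (B 1) x = D 1 (B 0) x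
  sw : ∀ x ∈ Ω, D 0 (w 1) x = D 1 (w 0) x

lemma nn_bound {δ0 δ1 N0 N1 : ℝ} (hN : N0 ^ 2 + N1 ^ 2 = 1) (h0 : |δ0| ≤ 1 / 40)
    (h1 : |δ1| ≤ 1 / 40) : (δ0 - N0) ^ 2 + (δ1 - N1) ^ 2 ≤ 1 + 5 / 40 := by
  have hN0 : |N0| ≤ 1 := abs_le_of_sq_le_sq (by linarith [sq_nonneg N1]) zero_le_one
  have hN1 : |N1| ≤ 1 := abs_le_of_sq_le_sq (by linarith [sq_nonneg N0]) zero_le_one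
  have a1 : |δ0 * N0| ≤ 1 / 40 := by
    rw [abs_mul]; exact (mul_le_mul h0 hN0 (abs_nonneg _) (by norm_num)).trans (by norm_num)
  have a2 : |δ1 * N1| ≤ 1 / 40 := by
    rw [abs_mul]; exact (mul_le_mul h1 hN1 (abs_nonneg _) (by norm_num)).trans (by norm_num)
  have a3 : δ0 ^ 2 ≤ (1/40)^2 := by rw [← sq_abs]; gcongr
  have a4 : δ1 ^ 2 ≤ (1/40)^2 := by rw [← sq_abs]; gcongr
  have b1 := neg_abs_le (δ0 * N0)
  have b2 := neg_abs_le (δ1 * N1)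
  have e : (δ0 - N0) ^ 2 + (δ1 - N1) ^ 2 =
    (N0 ^ 2 + N1 ^ 2) + δ0 ^ 2 + δ1 ^ 2 - 2 * (δ0 * N0) - 2 * (δ1 * N1) := by ring
  rw [e, hN]; linarith

lemma mb1 {m : ℝ} (hm0 : 0 ≤ m) (hm1 : m ≤ 1) : |3 / 2 * m ^ 2 - m| ≤ 1 / 2 := by
  rw [abs_le]; constructor <;> nlinarith [sq_nonneg (3 * m - 1)]
lemma mb2 {m : ℝ} (hm0 : 0 ≤ m) (hm1 : m ≤ 1) : |m - 1 / 2 * m ^ 2| ≤ 1 / 2 := by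
  rw [abs_le]; constructor <;> nlinarith [sq_nonneg (m - 1)]

set_option maxHeartbeats 1000000 in
/-- pointwise coercivity -/
lemma coer {m N0 N1 n0 n1 P00 P01 P10 P11 w0 w1 d r : ℝ} (hr : 0 < r) (hm0 : 0 ≤ m) (hm1 : m ≤ 1)
    (hd0 : 0 ≤ d) (hd : m ≠ 0 → d ≤ r / 40) (hN : N0 ^ 2 + N1 ^ 2 = 1)
    (h0 : |N0 + n0| ≤ d / r) (h1 : |N1 + n1| ≤ d / r)
    (hn0 : |n0| ≤ 1) (hn1 : |n1| ≤ 1) (hP00 : |P00| ≤ 1 / r) (hP01 : |P01| ≤ 1 / r)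
    (hP10 : |P10| ≤ 1 / r) (hP11 : |P11| ≤ 1 / r) :
    1 / 4 * (w0 ^ 2 + w1 ^ 2) ≤ (w0 ^ 2 + w1 ^ 2) +
      (m ^ 2 * (n0 ^ 2 - n1 ^ 2)) * (w0 ^ 2 - w1 ^ 2) + (m ^ 2 * (2 * n0 * n1)) * (2 * w0 * w1) +
      ((N0 * (3 / 2 * m ^ 2 - m) * n0 + 1 / 2 * d * m ^ 2 * P00) -
       (N1 * (3 / 2 * m ^ 2 - m) * n1 + 1 / 2 * d * m ^ 2 * P11)) * (w0 ^ 2 - w1 ^ 2) +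
      ((N1 * (3 / 2 * m ^ 2 - m) * n0 + 1 / 2 * d * m ^ 2 * P10) +
       (N0 * (3 / 2 * m ^ 2 - m) * n1 + 1 / 2 * d * m ^ 2 * P01)) * (2 * w0 * w1) := by
  set Z := w0 ^ 2 + w1 ^ 2 with hZ
  have hZ0 : 0 ≤ Z := by positivity
  by_cases hm : m = 0
  · subst hm; simp; linarith
  have hd := hd hm
  have hdr : d / r ≤ 1 / 40 := by rw [div_le_iff₀ hr]; linarith
  obtain ⟨δ0, rfl⟩ : ∃ δ0, n0 = δ0 - N0 := ⟨n0 + N0, by ring⟩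
  obtain ⟨δ1, rfl⟩ : ∃ δ1, n1 = δ1 - N1 := ⟨n1 + N1, by ring⟩
  have k0 : |δ0| ≤ 1 / 40 := by have := h0.trans hdr; simpa using this
  have k1 : |δ1| ≤ 1 / 40 := by have := h1.trans hdr; simpa using this
  set n0 := δ0 - N0 with hn0d
  set n1 := δ1 - N1 with hn1d
  have hR : |w0 ^ 2 - w1 ^ 2| ≤ Z := by
    rw [abs_le]; constructor <;> linarith [sq_nonneg w0, sq_nonneg w1]
  have hS : |2 * w0 * w1| ≤ Z := by
    rw [abs_le]; constructor <;> nlinarith [sq_nonneg (w0 + w1), sq_nonneg (w0 - w1)]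
  set R := w0 ^ 2 - w1 ^ 2 with hRd
  set S := 2 * w0 * w1 with hSd
  have hRS : R ^ 2 + S ^ 2 = Z ^ 2 := by rw [hRd, hSd, hZ]; ring
  have hnn : n0 ^ 2 + n1 ^ 2 ≤ 1 + 5 / 40 := nn_bound hN k0 k1
  set X := (n0 ^ 2 - n1 ^ 2) * R + 2 * n0 * n1 * S with hX
  have hXb : |X| ≤ (1 + 5 / 40) * Z := by
    apply abs_le_of_sq_le_sq _ (by positivity)
    have e1 : X ^ 2 + (2 * n0 * n1 * R - (n0 ^ 2 - n1 ^ 2) * S) ^ 2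
        = (n0 ^ 2 + n1 ^ 2) ^ 2 * Z ^ 2 := by
      rw [← hRS, hX]; ring
    calc X ^ 2 ≤ (n0 ^ 2 + n1 ^ 2) ^ 2 * Z ^ 2 := by
          nlinarith [sq_nonneg (2 * n0 * n1 * R - (n0 ^ 2 - n1 ^ 2) * S)]
      _ ≤ (1 + 5 / 40) ^ 2 * Z ^ 2 := by gcongr
      _ = _ := by ring
  set s := 3 / 2 * m ^ 2 - m with hs
  have hsb : |s| ≤ 1 / 2 := mb1 hm0 hm1
  set p := 1 / 2 * d * m ^ 2 with hp
  have hp0 : 0 ≤ p := by positivity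
  have hpb : p ≤ r / 80 := by
    have : m ^ 2 ≤ 1 := by nlinarith
    rw [hp]; nlinarith
  have bd : ∀ u v c e f : ℝ, |u| ≤ c → |v| ≤ e → 0 ≤ c → c * e ≤ f → |u * v| ≤ f := by
    intro u v c e f h1 h2 h3 h4
    rw [abs_mul]
    exact (mul_le_mul h1 h2 (abs_nonneg _) h3).trans h4
  have E1 : ∀ δ n V : ℝ, |δ| ≤ 1 / 40 → |n| ≤ 1 → |V| ≤ Z → |s * (δ * n * V)| ≤ 1 / 80 * Z := by
    intro δ n V a b c
    refine bd _ _ (1/2) (1/40 * Z) _ hsb ?_ (by norm_num) (by linarith)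
    refine bd _ _ (1/40) Z _ ?_ c (by norm_num) le_rfl
    exact bd _ _ (1/40) 1 _ a b (by norm_num) (by norm_num)
  have E2 : ∀ P V : ℝ, |P| ≤ 1 / r → |V| ≤ Z → |p * P * V| ≤ 1 / 80 * Z := by
    intro P V a b
    refine bd _ _ (1/80) Z _ ?_ b (by norm_num) le_rfl
    refine bd _ _ (r/80) (1/r) _ (by rw [abs_of_nonneg hp0]; exact hpb) a (by positivity) ?_
    apply le_of_eq; field_simp
  have f1 := neg_abs_le (s * (δ0 * n0 * R)); have g1 := E1 δ0 n0 R k0 hn0 hR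
  have f2 := le_abs_self (s * (δ1 * n1 * R)); have g2 := E1 δ1 n1 R k1 hn1 hR
  have f3 := neg_abs_le (s * (δ1 * n0 * S)); have g3 := E1 δ1 n0 S k1 hn0 hS
  have f4 := neg_abs_le (s * (δ0 * n1 * S)); have g4 := E1 δ0 n1 S k0 hn1 hS
  have f5 := neg_abs_le (p * P00 * R); have g5 := E2 P00 R hP00 hR
  have f6 := le_abs_self (p * P11 * R); have g6 := E2 P11 R hP11 hR
  have f7 := neg_abs_le (p * P10 * S); have g7 := E2 P10 S hP10 hS
  have f8 := neg_abs_le (p * P01 * S); have g8 := E2 P01 S hP01 hS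
  have f9 : |(m - 1 / 2 * m ^ 2) * X| ≤ 1 / 2 * ((1 + 5 / 40) * Z) := by
    refine bd _ _ (1/2) _ _ ?_ hXb (by norm_num) le_rfl
    exact mb2 hm0 hm1
  have f10 := neg_abs_le ((m - 1 / 2 * m ^ 2) * X)
  have eN0 : N0 = δ0 - n0 := by rw [hn0d]; ring
  have eN1 : N1 = δ1 - n1 := by rw [hn1d]; ring
  have tot : Z + m ^ 2 * (n0 ^ 2 - n1 ^ 2) * R + m ^ 2 * (2 * n0 * n1) * S +
      (N0 * s * n0 + p * P00 - (N1 * s * n1 + p * P11)) * R +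
      (N1 * s * n0 + p * P10 + (N0 * s * n1 + p * P01)) * S =
      Z + (m - 1 / 2 * m ^ 2) * X + s * (δ0 * n0 * R) - s * (δ1 * n1 * R) + s * (δ1 * n0 * S) +
        s * (δ0 * n1 * S) + p * P00 * R - p * P11 * R + p * P10 * S + p * P01 * S := by
    rw [hX, eN0, eN1, hs]; ring
  rw [tot]
  linarith

end

end

section

section
variable {Ω : Set E2} {r : ℝ} {ν : E2 → E2}

lemma Fx.ineq (G : Geo Ω r ν) {h q h2 q2 one q1 K : E2 → ℝ} (hF : Fx Ω h q) (hT : Fx Ω h2 q2)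
    (h1 : Fx Ω one q1) (hone : ∀ x ∈ frontier Ω, one x = 1) (hK : Continuous K)
    (hK0 : ∀ x, 0 ≤ K x) {c : ℝ} (hc : 0 ≤ c)
    (hb : ∀ x ∈ frontier Ω, h x ≤ c * K x + h2 x) :
    ∫ x in Ω, q x ≤ c * (CH * (∫ x in frontier Ω, K x ∂μH[1])) + (∫ x in Ω, q2 x) := by
  have key : ∀ ε > 0, ∫ x in Ω, q x ≤
      c * ((CH * (∫ x in frontier Ω, K x ∂μH[1])) + ε) + (∫ x in Ω, q2 x) + ε * (∫ x in Ω, q1 x) := by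
    intro ε hε
    have ev1 := G.wd_compare hF.ct (Ψ := fun x => c * K x + h2 x + ε * one x)
      (((continuousOn_const.mul hK.continuousOn).add hT.ct).add (continuousOn_const.mul h1.ct))
      (fun x hx => by rw [hone x hx]; linarith [hb x hx])
    have ev2 := G.layer hK hK0 hε
    have L : Tendsto (fun δ => c * ((CH * (∫ x in frontier Ω, K x ∂μH[1])) + ε) +
        (∫ x in Ω, wd Ω δ x * h2 x) + ε * (∫ x in Ω, wd Ω δ x * one x)) (𝓝[>] 0)
        (𝓝 (c * ((CH * (∫ x in frontier Ω, K x ∂μH[1])) + ε) + (∫ x in Ω, q2 x) +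
          ε * (∫ x in Ω, q1 x))) :=
      (tendsto_const_nhds.add hT.lim).add (h1.lim.const_mul ε)
    refine le_of_tendsto_of_tendsto hF.lim L ?_
    filter_upwards [ev1, ev2] with δ a1 a2
    refine a1.trans ?_
    have i1 := G.int_wd δ (f := K) hK.continuousOn
    have i2 := G.int_wd δ hT.ct
    have i3 := G.int_wd δ h1.ct
    have : ∫ x in Ω, wd Ω δ x * (c * K x + h2 x + ε * one x) =
        c * (∫ x in Ω, wd Ω δ x * K x) + (∫ x in Ω, wd Ω δ x * h2 x) +
          ε * (∫ x in Ω, wd Ω δ x * one x) := by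
      rw [← integral_const_mul, ← integral_const_mul, ← integral_add (i1.const_mul c) i2,
        ← integral_add ((i1.const_mul c).fun_add i2) (i3.const_mul ε)]
      congr 1; ext x; ring
    rw [this]
    have := mul_le_mul_of_nonneg_left a2 hc
    linarith
  have L : Tendsto (fun ε : ℝ => c * ((CH * (∫ x in frontier Ω, K x ∂μH[1])) + ε) +
      (∫ x in Ω, q2 x) + ε * (∫ x in Ω, q1 x)) (𝓝[>] 0)
      (𝓝 (c * ((CH * (∫ x in frontier Ω, K x ∂μH[1])) + 0) + (∫ x in Ω, q2 x) +
        0 * (∫ x in Ω, q1 x))) := by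
    apply Tendsto.mono_left _ nhdsWithin_le_nhds
    apply Continuous.tendsto
    fun_prop
  have := ge_of_tendsto L (b := ∫ x in Ω, q x)
    (by filter_upwards [self_mem_nhdsWithin] with ε hε using key ε hε)
  simpa using this

lemma max_sq_deriv (s : ℝ) : HasDerivAt (fun s : ℝ => max 0 s ^ 2) (2 * max 0 s) s := by
  rcases lt_trichotomy s 0 with h | h | h
  · rw [max_eq_left h.le, mul_zero]
    refine (hasDerivAt_const s (0:ℝ)).congr_of_eventuallyEq ?_
    filter_upwards [gt_mem_nhds h] with t ht
    rw [max_eq_left ht.le]; norm_num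
  · subst h
    rw [hasDerivAt_iff_isLittleO]
    simp only [max_self, mul_zero, smul_zero, sub_zero, ne_eq, OfNat.ofNat_ne_zero,
      not_false_eq_true, zero_pow]
    have : (fun x : ℝ => x ^ 2) =o[𝓝 0] (fun x => x) := by
      simpa using Asymptotics.isLittleO_pow_pow (𝕜 := ℝ) (m := 1) (n := 2) (by norm_num)
    refine (Asymptotics.IsBigO.of_bound 1 ?_).trans_isLittleO this
    filter_upwards with x
    rw [one_mul, Real.norm_eq_abs, Real.norm_eq_abs, abs_of_nonneg (sq_nonneg _),
      abs_of_nonneg (sq_nonneg _)]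
    rcases le_total x 0 with h | h
    · rw [max_eq_left h]; nlinarith [sq_nonneg x]
    · rw [max_eq_right h]
  · rw [max_eq_right h.le]
    have := (hasDerivAt_id s).fun_pow 2
    refine (this.congr_of_eventuallyEq ?_).congr_deriv (by simp)
    filter_upwards [lt_mem_nhds h] with t ht
    rw [max_eq_right ht.le]; simp

def cm (r t : ℝ) : ℝ := max 0 (1 - 40 / r * t)

lemma cm_sq_deriv (r t : ℝ) : HasDerivAt (fun t => cm r t ^ 2) (-(80 / r) * cm r t) t := by
  have h1 : HasDerivAt (fun t : ℝ => 1 - 40 / r * t) (-(40/r)) t := by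
    simpa using ((hasDerivAt_id t).const_mul (40/r)).const_sub 1
  have := (max_sq_deriv (1 - 40 / r * t)).comp t h1
  exact this.congr_deriv (by unfold cm; ring)

lemma cm_rel {r t : ℝ} : cm r t * (40 / r * t) = cm r t - cm r t ^ 2 := by
  unfold cm
  rcases le_total (1 - 40 / r * t) 0 with h | h
  · rw [max_eq_left h]; ring
  · rw [max_eq_right h]; ring

lemma psi_deriv (r t : ℝ) :
    HasDerivAt (fun t => 1 / 2 * t * cm r t ^ 2) (3 / 2 * cm r t ^ 2 - cm r t) t := by
  have h1 := ((hasDerivAt_id t).const_mul (1/2:ℝ)).mul (cm_sq_deriv r t)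
  refine h1.congr_deriv ?_
  have := @cm_rel r t
  simp only [id]
  linear_combination (-1 : ℝ) * this

lemma cm_nonneg (r t : ℝ) : 0 ≤ cm r t := le_max_left _ _
lemma cm_le {r t : ℝ} (hr : 0 < r) (ht : 0 ≤ t) : cm r t ≤ 1 := by
  refine max_le zero_le_one ?_
  have : 0 ≤ 40 / r * t := by positivity
  linarith
lemma cm_ne {r t : ℝ} (hr : 0 < r) (h : cm r t ≠ 0) : t ≤ r / 40 := by
  by_contra hc
  push Not at hc
  apply h
  apply max_eq_left
  have : 40 / r * (r / 40) ≤ 40 / r * t := by gcongr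
  have e : 40 / r * (r / 40) = 1 := by field_simp
  linarith
lemma cm_lip {r : ℝ} (hr : 0 < r) (a b : ℝ) : |cm r a - cm r b| ≤ 40 / r * |a - b| := by
  unfold cm
  have := abs_max_sub_max_le_abs (1 - 40 / r * a) (1 - 40 / r * b) 0
  rw [max_comm, max_comm 0]
  refine this.trans (le_of_eq ?_)
  rw [show 1 - 40 / r * a - (1 - 40 / r * b) = - (40 / r * (a - b)) by ring, abs_neg, abs_mul,
    abs_of_nonneg (by positivity : (0:ℝ) ≤ 40 / r)]

lemma D_comp {g : ℝ → ℝ} {f : E2 → ℝ} {x : E2} {g' : ℝ} (i : Fin 2) (hg : HasDerivAt g g' (f x))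
    (hf : DifferentiableAt ℝ f x) : DifferentiableAt ℝ (fun y => g (f y)) x ∧
      D i (fun y => g (f y)) x = D i f x * g' := by
  have := hg.comp_hasFDerivAt x hf.hasFDerivAt
  refine ⟨this.differentiableAt, ?_⟩
  unfold D
  have e : fderiv ℝ (fun y => g (f y)) x = g' • fderiv ℝ f x := this.fderiv
  rw [e]; simp [mul_comm]

set_option maxHeartbeats 1000000 in
lemma ptw {e1 e2 om A0 A1 B0 B1 w0 w1 b10 b11 b20 b21 n0 n1 P00 P11 M c r : ℝ} (hr : 0 < r)
    (hc : 0 ≤ c) (hM : 1 / 4 * (w0 ^ 2 + w1 ^ 2) ≤ M)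
    (hrel : 2 * (A1 * B0 - A0 * B1) = A0 ^ 2 + A1 ^ 2 + B0 ^ 2 + B1 ^ 2 - 1 / 4 * (w0 ^ 2 + w1 ^ 2))
    (h10 : |b10| ≤ 84 / r) (h11 : |b11| ≤ 84 / r) (h20 : |b20| ≤ 164 / r) (h21 : |b21| ≤ 164 / r)
    (hn0 : |n0| ≤ 1) (hn1 : |n1| ≤ 1) (hP00 : |P00| ≤ 1 / r) (hP11 : |P11| ≤ 1 / r) :
    1 / 2 * (A0 ^ 2 + A1 ^ 2 + B0 ^ 2 + B1 ^ 2 + w0 ^ 2 + w1 ^ 2) ≤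
      (8 * (M + b10 * (2 * (e2 * w0) + (-2) * (om * A1)) + b11 * (2 * (e2 * w1) + 2 * (om * A0)) +
        b20 * ((-2) * (e1 * w0) + (-2) * (om * B1)) + b21 * ((-2) * (e1 * w1) + 2 * (om * B0))) +
        2 * (A1 * B0 - A0 * B1)) -
      c / r * (P00 * (e1 ^ 2 + e2 ^ 2 + om ^ 2) + n0 * (2 * (e1 * A0 + e2 * B0 + om * w0)) +
        (P11 * (e1 ^ 2 + e2 ^ 2 + om ^ 2) + n1 * (2 * (e1 * A1 + e2 * B1 + om * w1)))) +
      (2 * c + (12 * c + 16000) ^ 2 / 2) / r ^ 2 * (e1 ^ 2 + e2 ^ 2 + om ^ 2) := by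
  set G := e1 ^ 2 + e2 ^ 2 + om ^ 2 with hG
  set Q := A0 ^ 2 + A1 ^ 2 + B0 ^ 2 + B1 ^ 2 + w0 ^ 2 + w1 ^ 2 with hQ
  have hG0 : 0 ≤ G := by positivity
  have hQ0 : 0 ≤ Q := by positivity
  set Y := √G
  set Z := √Q
  have hY0 : 0 ≤ Y := Real.sqrt_nonneg _
  have hZ0 : 0 ≤ Z := Real.sqrt_nonneg _
  have hYY : Y ^ 2 = G := Real.sq_sqrt hG0
  have hZZ : Z ^ 2 = Q := Real.sq_sqrt hQ0
  have bY : ∀ a : ℝ, a ^ 2 ≤ G → |a| ≤ Y := fun a h => Real.abs_le_sqrt h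
  have bZ : ∀ a : ℝ, a ^ 2 ≤ Q → |a| ≤ Z := fun a h => Real.abs_le_sqrt h
  have pr : ∀ a b : ℝ, |a| ≤ Y → |b| ≤ Z → |a * b| ≤ Y * Z := fun a b h1 h2 => by
    rw [abs_mul]; exact mul_le_mul h1 h2 (abs_nonneg _) hY0
  have y1 : |e1| ≤ Y := bY _ (by rw [hG]; linarith [sq_nonneg e2, sq_nonneg om])
  have y2 : |e2| ≤ Y := bY _ (by rw [hG]; linarith [sq_nonneg e1, sq_nonneg om])
  have y3 : |om| ≤ Y := bY _ (by rw [hG]; linarith [sq_nonneg e2, sq_nonneg e1])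
  have s1 := sq_nonneg A0; have s2 := sq_nonneg A1; have s3 := sq_nonneg B0
  have s4 := sq_nonneg B1; have s5 := sq_nonneg w0; have s6 := sq_nonneg w1
  have z1 : |A0| ≤ Z := bZ _ (by rw [hQ]; linarith)
  have z2 : |A1| ≤ Z := bZ _ (by rw [hQ]; linarith)
  have z3 : |B0| ≤ Z := bZ _ (by rw [hQ]; linarith)
  have z4 : |B1| ≤ Z := bZ _ (by rw [hQ]; linarith)
  have z5 : |w0| ≤ Z := bZ _ (by rw [hQ]; linarith)
  have z6 : |w1| ≤ Z := bZ _ (by rw [hQ]; linarith)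
  have hYZ : 0 ≤ Y * Z := mul_nonneg hY0 hZ0
  have two : ∀ b c a a' L : ℝ, |b| ≤ L → (|c| ≤ 4 * (Y * Z)) → -(L * (4 * (Y * Z))) ≤ b * c := by
    intro b c a a' L h1 h2
    have : |b * c| ≤ L * (4 * (Y * Z)) := by
      rw [abs_mul]; exact mul_le_mul h1 h2 (abs_nonneg _) ((abs_nonneg _).trans h1)
    exact (abs_le.1 this).1
  have lin : ∀ a b : ℝ, |a| ≤ Y * Z → |b| ≤ Y * Z → ∀ s t : ℝ, |s| = 2 → |t| = 2 →
      |s * a + t * b| ≤ 4 * (Y * Z) := by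
    intro a b h1 h2 s t hs ht
    refine (abs_add_le _ _).trans ?_
    rw [abs_mul, abs_mul, hs, ht]; linarith
  have p2 : |(2:ℝ)| = 2 := by norm_num
  have m2 : |(-2:ℝ)| = 2 := by norm_num
  have k1 := two b10 _ 0 0 _ h10 (lin _ _ (pr e2 w0 y2 z5) (pr om A1 y3 z2) 2 (-2) p2 m2)
  have k2 := two b11 _ 0 0 _ h11 (lin _ _ (pr e2 w1 y2 z6) (pr om A0 y3 z1) 2 2 p2 p2)
  have k3 := two b20 _ 0 0 _ h20 (lin _ _ (pr e1 w0 y1 z5) (pr om B1 y3 z4) (-2) (-2) m2 m2)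
  have k4 := two b21 _ 0 0 _ h21 (lin _ _ (pr e1 w1 y1 z6) (pr om B0 y3 z3) (-2) 2 m2 p2)
  have six : ∀ n a b d : ℝ, |n| ≤ 1 → |a| ≤ Y * Z → |b| ≤ Y * Z → |d| ≤ Y * Z →
      n * (2 * (a + b + d)) ≤ 6 * (Y * Z) := by
    intro n a b d hn ha hb hd
    have : |2 * (a + b + d)| ≤ 6 * (Y * Z) := by
      rw [abs_mul, p2]
      have := abs_add_three a b d
      linarith
    have h : |n * (2 * (a + b + d))| ≤ 1 * (6 * (Y * Z)) := by
      rw [abs_mul]; exact mul_le_mul hn this (abs_nonneg _) zero_le_one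
    linarith [(abs_le.1 h).2]
  have t1 := six n0 _ _ _ hn0 (pr e1 A0 y1 z1) (pr e2 B0 y2 z3) (pr om w0 y3 z5)
  have t2 := six n1 _ _ _ hn1 (pr e1 A1 y1 z2) (pr e2 B1 y2 z4) (pr om w1 y3 z6)
  have t3 : P00 * G ≤ 1 / r * G := by gcongr; exact (abs_le.1 hP00).2
  have t4 : P11 * G ≤ 1 / r * G := by gcongr; exact (abs_le.1 hP11).2
  have T : P00 * G + n0 * (2 * (e1 * A0 + e2 * B0 + om * w0)) +
        (P11 * G + n1 * (2 * (e1 * A1 + e2 * B1 + om * w1))) ≤ 2 / r * G + 12 * (Y * Z) := by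
    have : 2 / r * G = 1 / r * G + 1 / r * G := by ring
    linarith
  have T' := mul_le_mul_of_nonneg_left T (by positivity : 0 ≤ c / r)
  have am : (12 * c + 16000) / r * (Y * Z) ≤
      1 / 2 * Q + (12 * c + 16000) ^ 2 / 2 / r ^ 2 * G := by
    rw [← hYY, ← hZZ]
    have := sq_nonneg (Z - (12 * c + 16000) / r * Y)
    have e : (Z - (12 * c + 16000) / r * Y) ^ 2 = Z ^ 2 - 2 * ((12 * c + 16000) / r * (Y * Z)) +
      2 * ((12 * c + 16000) ^ 2 / 2 / r ^ 2 * Y ^ 2) := by field_simp; ring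
    rw [e] at this
    linarith
  have e1' : c / r * (2 / r * G + 12 * (Y * Z)) = 2 * c / r ^ 2 * G + 12 * c / r * (Y * Z) := by
    field_simp
  have e2' : (12 * c + 16000) / r * (Y * Z) = 12 * c / r * (Y * Z) + 16000 / r * (Y * Z) := by
    ring
  have e3' : (2 * c + (12 * c + 16000) ^ 2 / 2) / r ^ 2 * G = 2 * c / r ^ 2 * G +
     (12 * c + 16000) ^ 2 / 2 / r ^ 2 * G := by ring
  have e4' : 8 * (84 / r * (4 * (Y * Z)) + 84 / r * (4 * (Y * Z)) + 164 / r * (4 * (Y * Z)) +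
     164 / r * (4 * (Y * Z))) ≤ 16000 / r * (Y * Z) := by
    have : 0 ≤ 1 / r * (Y * Z) := by positivity
    have e : 16000 / r * (Y * Z) - 8 * (84 / r * (4 * (Y * Z)) + 84 / r * (4 * (Y * Z)) +
      164 / r * (4 * (Y * Z)) + 164 / r * (4 * (Y * Z))) = 128 * (1 / r * (Y * Z)) := by ring
    linarith
  rw [e3', hrel]
  rw [e1'] at T'
  have hQ' := hQ
  linarith

end

end

section

section
variable {Ω : Set E2} {r : ℝ} {ν : E2 → E2}

lemma coeffs (G : Geo Ω r ν) {n : Fin 2 → E2 → ℝ} (hn : ∀ i, Lp (1/r) (n i))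
    (hn1 : ∀ i x, |n i x| ≤ 1) :
    (Lp (84 / r) (fun x => cm r (dd Ω x) ^ 2 * (n 0 x ^ 2 - n 1 x ^ 2))) ∧
    (∀ x, |cm r (dd Ω x) ^ 2 * (n 0 x ^ 2 - n 1 x ^ 2)| ≤ 1) ∧
    (Lp (164 / r) (fun x => cm r (dd Ω x) ^ 2 * (2 * n 0 x * n 1 x))) ∧
    (∀ x, |cm r (dd Ω x) ^ 2 * (2 * n 0 x * n 1 x)| ≤ 2) ∧
    (∀ j, ∃ K B, Lp K (fun x => 1 / 2 * dd Ω x * cm r (dd Ω x) ^ 2 * n j x) ∧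
      ∀ x, |1 / 2 * dd Ω x * cm r (dd Ω x) ^ 2 * n j x| ≤ B) := by
  have hr := G.rpos
  have m0 : ∀ x, |cm r (dd Ω x)| ≤ 1 := fun x => by
    rw [abs_of_nonneg (cm_nonneg _ _)]; exact cm_le hr (dd_nonneg _ _)
  have mL : Lp (40 / r * 1) (fun x => cm r (dd Ω x)) :=
    (dd_lp Ω).comp (by positivity) (cm_lip hr)
  have m2 := mL.mul mL m0 m0
  have bd : ∀ {a b A B : ℝ}, |a| ≤ A → |b| ≤ B → |a * b| ≤ A * B := fun h1 h2 => by
    rw [abs_mul]; exact mul_le_mul h1 h2 (abs_nonneg _) ((abs_nonneg _).trans h1)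
  have m2b : ∀ x, |cm r (dd Ω x) * cm r (dd Ω x)| ≤ 1 := fun x => by
    simpa using bd (m0 x) (m0 x)
  have hsub := ((hn 0).mul (hn 0) (hn1 0) (hn1 0)).sub ((hn 1).mul (hn 1) (hn1 1) (hn1 1))
  have hsubb : ∀ x, |n 0 x * n 0 x - n 1 x * n 1 x| ≤ 1 := fun x => by
    have h0 : |n 0 x * n 0 x| ≤ 1 := by simpa using bd (hn1 0 x) (hn1 0 x)
    have h1 : |n 1 x * n 1 x| ≤ 1 := by simpa using bd (hn1 1 x) (hn1 1 x)
    rw [abs_le] at *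
    constructor <;> nlinarith [mul_self_nonneg (n 0 x), mul_self_nonneg (n 1 x)]
  have hpr := ((Lp.const 2).mul ((hn 0).mul (hn 1) (hn1 0) (hn1 1)) (A := 2) (B := 1)
    (fun x => by norm_num) (fun x => by simpa using bd (hn1 0 x) (hn1 1 x)))
  have hprb : ∀ x, |2 * (n 0 x * n 1 x)| ≤ 2 := fun x => by
    have h0 : |n 0 x * n 1 x| ≤ 1 := by simpa using bd (hn1 0 x) (hn1 1 x)
    rw [abs_mul, abs_of_pos (by norm_num : (0:ℝ) < 2)]; linarith
  have hmin : Lp (1 * 1) (fun x => min (dd Ω x) (r / 40)) := (dd_lp Ω).comp zero_le_one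
    (g := fun t => min t (r / 40)) (fun a b => by
      rw [one_mul]; simpa using abs_min_sub_min_le_max a (r / 40) b (r / 40))
  have hminb : ∀ x, |min (dd Ω x) (r / 40)| ≤ r / 40 := fun x => by
    rw [abs_of_nonneg (le_min (dd_nonneg _ _) (by positivity))]; exact min_le_right _ _
  have e1 := m2.mul hsub m2b hsubb
  have e2 := m2.mul hpr m2b hprb
  have f1 : (fun x => cm r (dd Ω x) * cm r (dd Ω x) * (n 0 x * n 0 x - n 1 x * n 1 x)) =
    (fun x => cm r (dd Ω x) ^ 2 * (n 0 x ^ 2 - n 1 x ^ 2)) := by ext x; ring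
  have f2 : (fun x => cm r (dd Ω x) * cm r (dd Ω x) * (2 * (n 0 x * n 1 x))) =
    (fun x => cm r (dd Ω x) ^ 2 * (2 * n 0 x * n 1 x)) := by ext x; ring
  refine ⟨?_, ?_, ?_, ?_, ?_⟩
  · rw [← f1]; exact e1.mono (le_of_eq (by ring))
  · intro x; rw [← congrFun f1 x]; simpa using bd (m2b x) (hsubb x)
  · rw [← f2]; exact e2.mono (le_of_eq (by ring))
  · intro x; rw [← congrFun f2 x]; simpa using bd (m2b x) (hprb x)
  · intro j
    have f3 : (fun x => 1 / 2 * (min (dd Ω x) (r / 40) * (cm r (dd Ω x) * cm r (dd Ω x)) * n j x)) =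
      (fun x => 1 / 2 * dd Ω x * cm r (dd Ω x) ^ 2 * n j x) := by
      ext x
      by_cases h : cm r (dd Ω x) = 0
      · rw [h]; ring
      · rw [min_eq_left (cm_ne hr h)]; ring
    have b1 : ∀ x, _ := fun x => bd (hminb x) (m2b x)
    have b2 : ∀ x, _ := fun x => bd (b1 x) (hn1 j x)
    have L1 := hmin.mul m2 hminb m2b
    have L2 := L1.mul (hn j) b1 (hn1 j)
    have L3 := (Lp.const (1/2)).mul L2 (A := 1/2) (fun x => by norm_num) b2
    have b3 : ∀ x, _ := fun x => bd (le_refl |(1/2:ℝ)|) (b2 x)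
    have b4 := fun x => (congrArg abs (congrFun f3 x)).symm.le.trans (b3 x)
    rw [f3] at L3
    exact ⟨_, _, L3, b4⟩

lemma fluxpt {θ r k om e1 e2 n0 n1 X : ℝ} (hr : 0 < r) (hθ : 0 < θ) (u : n0 ^ 2 + n1 ^ 2 = 1)
    (hX : X ≤ 2 / r * (e1 ^ 2 + e2 ^ 2)) : 8 * om * k + X ≤ θ * r * k ^ 2 +
      (16 / θ + 2) / r * (n0 * (e1 * e1 + e2 * e2 + om * om) * n0 +
        n1 * (e1 * e1 + e2 * e2 + om * om) * n1) := by
  have h1 : n0 * (e1 * e1 + e2 * e2 + om * om) * n0 + n1 * (e1 * e1 + e2 * e2 + om * om) * n1 =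
    e1 ^ 2 + e2 ^ 2 + om ^ 2 := by linear_combination (e1 ^ 2 + e2 ^ 2 + om ^ 2) * u
  rw [h1]
  have h2 : (16 / θ + 2) / r * (e1 ^ 2 + e2 ^ 2 + om ^ 2) = 16 / (θ * r) * om ^ 2 +
    2 / r * (e1 ^ 2 + e2 ^ 2) + (16 / (θ * r) * (e1 ^ 2 + e2 ^ 2) + 2 / r * om ^ 2) := by
    field_simp; ring
  rw [h2]
  have h3 : 0 ≤ 16 / (θ * r) * (e1 ^ 2 + e2 ^ 2) + 2 / r * om ^ 2 := by positivity
  have h4 : 8 * om * k ≤ θ * r * k ^ 2 + 16 / (θ * r) * om ^ 2 := by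
    have h5 : θ * r * k ^ 2 + 16 / (θ * r) * om ^ 2 - 8 * om * k =
      θ * r * (k - 4 / (θ * r) * om) ^ 2 := by field_simp; ring
    have : 0 ≤ θ * r * (k - 4 / (θ * r) * om) ^ 2 := by positivity
    linarith
  linarith

set_option maxHeartbeats 2000000 in
theorem core (G : Geo Ω r ν) {e1 e2 om : E2 → ℝ} {A B w : Fin 2 → E2 → ℝ}
    (P : PDE Ω e1 e2 om A B w) {k K : E2 → ℝ} (hK : Continuous K) (hK0 : ∀ x, 0 ≤ K x)
    (hKk : ∀ x ∈ frontier Ω, K x = k x ^ 2)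
    (b1 : ∀ x ∈ frontier Ω, (ν x 0 ^ 2 - ν x 1 ^ 2) * e2 x = 2 * ν x 0 * ν x 1 * e1 x)
    (b2 : ∀ x ∈ frontier Ω, (w 0 x * ν x 0 + w 1 x * ν x 1) -
      2 * ((ν x 0 ^ 2 - ν x 1 ^ 2) * (ν x 0 * A 1 x - ν x 1 * A 0 x) +
        2 * ν x 0 * ν x 1 * (ν x 0 * B 1 x - ν x 1 * B 0 x)) = k x)
    (b3 : ∀ x ∈ frontier Ω, e2 x * (ν x 0 * A 1 x - ν x 1 * A 0 x) -
      e1 x * (ν x 0 * B 1 x - ν x 1 * B 0 x) ≤ 2 / r * (e1 x ^ 2 + e2 x ^ 2))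
    {θ c : ℝ} (hθ : 0 < θ) (hcθ : c = 16 / θ + 2) :
    ∫ x in Ω, (A 0 x ^ 2 + A 1 x ^ 2 + B 0 x ^ 2 + B 1 x ^ 2 + w 0 x ^ 2 + w 1 x ^ 2) ≤
      2 * (θ * r * (CH * ∫ x in frontier Ω, K x ∂μH[1])) +
      2 * ((2 * c + (12 * c + 16000) ^ 2 / 2) / r ^ 2) *
        ∫ x in Ω, (e1 x ^ 2 + e2 x ^ 2 + om x ^ 2) := by
  have hr := G.rpos
  have hc : 0 ≤ c := by rw [hcθ]; positivity
  obtain ⟨n, hn, hn1, hnf⟩ := G.exists_ext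
  obtain ⟨c1, c1b, c2, c2b, ca⟩ := coeffs G hn hn1
  obtain ⟨K0, B0, a0, a0b⟩ := ca 0
  obtain ⟨K1, B1, a1, a1b⟩ := ca 1
  have u1 : ∀ x : E2, |(1:ℝ)| ≤ 1 := fun x => by norm_num
  have F0 := Fx.pair G hn hnf (Lp.const 1) u1
    (Good.bil G P.gom (P.gw 0) P.gom (P.gw 0) 1 0) (Good.bil G P.gom (P.gw 1) P.gom (P.gw 1) 1 0)
    (fun x => w 0 x ^ 2 + w 1 x ^ 2) (fun x hx => by
      rw [D_bil G P.gom (P.gw 0) P.gom (P.gw 0) 1 0 0 hx,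
        D_bil G P.gom (P.gw 1) P.gom (P.gw 1) 1 0 1 hx, P.dw 0 x hx, P.dw 1 x hx]
      linear_combination om x * P.harm x hx)
  have F1 := Fx.pair G hn hnf c1 c1b
    (Good.bil G P.ge2 (P.gw 0) P.gom (P.gA 1) 2 (-2)) (Good.bil G P.ge2 (P.gw 1) P.gom (P.gA 0) 2 2)
    (fun x => w 0 x ^ 2 - w 1 x ^ 2) (fun x hx => by
      rw [D_bil G P.ge2 (P.gw 0) P.gom (P.gA 1) 2 (-2) 0 hx,
        D_bil G P.ge2 (P.gw 1) P.gom (P.gA 0) 2 2 1 hx, P.dw 0 x hx, P.dw 1 x hx,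
        P.dB 0 x hx, P.dB 1 x hx]
      linear_combination 2 * e2 x * P.harm x hx - 2 * om x * P.sA x hx + 2 * w 0 x * P.r2 x hx +
        2 * w 1 x * P.r1 x hx)
  have F2 := Fx.pair G hn hnf c2 c2b
    (Good.bil G P.ge1 (P.gw 0) P.gom (P.gB 1) (-2) (-2))
    (Good.bil G P.ge1 (P.gw 1) P.gom (P.gB 0) (-2) 2)
    (fun x => 2 * w 0 x * w 1 x) (fun x hx => by
      rw [D_bil G P.ge1 (P.gw 0) P.gom (P.gB 1) (-2) (-2) 0 hx,
        D_bil G P.ge1 (P.gw 1) P.gom (P.gB 0) (-2) 2 1 hx, P.dw 0 x hx, P.dw 1 x hx,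
        P.dA 0 x hx, P.dA 1 x hx]
      linear_combination (-2) * e1 x * P.harm x hx - 2 * om x * P.sB x hx -
        2 * w 0 x * P.r1 x hx + 2 * w 1 x * P.r2 x hx)
  have F3 := Fx.pair G hn hnf a0 a0b
    (Good.bil G (P.gw 0) (P.gw 0) (P.gw 1) (P.gw 1) 1 (-1))
    (Good.bil G (P.gw 0) (P.gw 1) (P.gw 0) (P.gw 1) 2 0)
    (fun x => 0) (fun x hx => by
      rw [D_bil G (P.gw 0) (P.gw 0) (P.gw 1) (P.gw 1) 1 (-1) 0 hx,
        D_bil G (P.gw 0) (P.gw 1) (P.gw 0) (P.gw 1) 2 0 1 hx]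
      linear_combination (2 * w 0 x) * P.harm x hx - 2 * w 1 x * P.sw x hx)
  have F4 := Fx.pair G hn hnf a1 a1b
    (Good.bil G (P.gw 0) (P.gw 1) (P.gw 0) (P.gw 1) 2 0)
    (Good.bil G (P.gw 1) (P.gw 1) (P.gw 0) (P.gw 0) 1 (-1))
    (fun x => 0) (fun x hx => by
      rw [D_bil G (P.gw 1) (P.gw 1) (P.gw 0) (P.gw 0) 1 (-1) 1 hx,
        D_bil G (P.gw 0) (P.gw 1) (P.gw 0) (P.gw 1) 2 0 0 hx]
      linear_combination (2 * w 1 x) * P.harm x hx + 2 * w 0 x * P.sw x hx)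
  have F5 := Fx.pair G hn hnf (Lp.const 1) u1
    (Good.bil G P.ge2 (P.gA 1) P.ge1 (P.gB 1) 1 (-1))
    (Good.bil G P.ge2 (P.gA 0) P.ge1 (P.gB 0) (-1) 1)
    (fun x => 2 * (A 1 x * B 0 x - A 0 x * B 1 x)) (fun x hx => by
      rw [D_bil G P.ge2 (P.gA 1) P.ge1 (P.gB 1) 1 (-1) 0 hx,
        D_bil G P.ge2 (P.gA 0) P.ge1 (P.gB 0) (-1) 1 1 hx,
        P.dA 0 x hx, P.dA 1 x hx, P.dB 0 x hx, P.dB 1 x hx]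
      linear_combination e2 x * P.sA x hx - e1 x * P.sB x hx)
  have F := (((((F0.add G F1).add G F2).add G F3).add G F4).smul 8).add G F5
  have gG := ((P.ge1.mul G P.ge1).add G (P.ge2.mul G P.ge2)).add G (P.gom.mul G P.gom)
  have T := ((Fx.of G hn hnf (hn 0) (hn1 0) gG 0).add G (Fx.of G hn hnf (hn 1) (hn1 1) gG 1)).smul
    (c / r)
  have O := (Fx.of G hn hnf (hn 0) (hn1 0) (Good.const 1) 0).add G
    (Fx.of G hn hnf (hn 1) (hn1 1) (Good.const 1) 1)
  have unit : ∀ x ∈ frontier Ω, ν x 0 ^ 2 + ν x 1 ^ 2 = 1 := fun x hx => by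
    rw [← norm_sq_two, G.unit x hx]; norm_num
  have main := Fx.ineq G F T O (fun x hx => by
      rw [hnf 0 x hx, hnf 1 x hx]; linarith [unit x hx]) hK hK0 (c := θ * r) (by positivity)
    (fun x hx => by
      have hd : dd Ω x = 0 := dd_out (not_mem_of_frontier G.op hx)
      have hm : cm r 0 = 1 := by unfold cm; norm_num
      simp only [hd, hm, hnf 0 x hx, hnf 1 x hx, bil]
      rw [hKk x hx, hcθ]
      refine le_of_eq_of_le ?_ (fluxpt hr hθ (k := k x) (om := om x) (unit x hx) (b3 x hx))
      rw [← b2 x hx]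
      linear_combination (16 * (w 0 x * ν x 0 + w 1 x * ν x 1)) * b1 x hx)
  have hct : ContinuousOn
      (fun x => A 0 x ^ 2 + A 1 x ^ 2 + B 0 x ^ 2 + B 1 x ^ 2 + w 0 x ^ 2 + w 1 x ^ 2)
      (closure Ω) :=
    (((((((P.gA 0).ct.pow 2).add ((P.gA 1).ct.pow 2)).add ((P.gB 0).ct.pow 2)).add
      ((P.gB 1).ct.pow 2)).add ((P.gw 0).ct.pow 2)).add ((P.gw 1).ct.pow 2))
  have iQ := G.intOn_ct hct
  have hctG : ContinuousOn (fun x => e1 x ^ 2 + e2 x ^ 2 + om x ^ 2) (closure Ω) :=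
    (((P.ge1.ct.pow 2).add (P.ge2.ct.pow 2)).add (P.gom.ct.pow 2))
  have iG := G.intOn_ct hctG
  have mono := integral_mono_ae (μ := volume.restrict Ω) (iQ.const_mul (1/2))
    ((F.int'.sub T.int').fun_add
      (iG.const_mul ((2 * c + (12 * c + 16000) ^ 2 / 2) / r ^ 2))) (by
    rw [Filter.EventuallyLE, ae_restrict_iff' G.op.measurableSet]
    filter_upwards [G.ae_dd hn hnf, (hn 0).ae_diff, (hn 1).ae_diff] with x hdd hd0 hd1 hx
    obtain ⟨hdx, hN, hNn⟩ := hdd hx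
    have hdj : ∀ j, DifferentiableAt ℝ (n j) x := fun j => by fin_cases j <;> assumption
    have Da : ∀ i j, D i (fun x => 1 / 2 * dd Ω x * cm r (dd Ω x) ^ 2 * n j x) x =
        D i (dd Ω) x * (3 / 2 * cm r (dd Ω x) ^ 2 - cm r (dd Ω x)) * n j x +
          1 / 2 * dd Ω x * cm r (dd Ω x) ^ 2 * D i (n j) x := by
      intro i j
      have h := D_comp (f := dd Ω) i (psi_deriv r (dd Ω x)) hdx
      rw [D_mul i h.1 (hdj j), h.2]
    have co := coer (w0 := w 0 x) (w1 := w 1 x) hr (cm_nonneg r (dd Ω x))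
      (cm_le hr (dd_nonneg Ω x)) (dd_nonneg Ω x) (cm_ne hr) hN (hNn 0) (hNn 1) (hn1 0 x) (hn1 1 x)
      ((hn 0).D_le 0 x) ((hn 1).D_le 0 x) ((hn 0).D_le 1 x) ((hn 1).D_le 1 x)
    have h := ptw (e1 := e1 x) (e2 := e2 x) (om := om x) (A0 := A 0 x) (A1 := A 1 x)
      (B0 := B 0 x) (B1 := B 1 x) hr hc co (by
        have h1 := P.r1 x hx
        have h2 := P.r2 x hx
        linear_combination (-(A 0 x + B 1 x - 1 / 2 * w 1 x)) * h1 - (B 0 x - A 1 x + 1 / 2 * w 0 x) * h2)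
      (c1.D_le 0 x) (c1.D_le 1 x) (c2.D_le 0 x) (c2.D_le 1 x) (hn1 0 x) (hn1 1 x)
      ((hn 0).D_le 0 x) ((hn 1).D_le 1 x)
    have DG : ∀ i, D i (fun x => e1 x * e1 x + e2 x * e2 x + om x * om x) x =
        2 * (e1 x * A i x + e2 x * B i x + om x * w i x) := by
      intro i
      have d1 := P.ge1.diff G.op hx
      have d2 := P.ge2.diff G.op hx
      have d3 := P.gom.diff G.op hx
      rw [D_add i ((d1.fun_mul d1).fun_add (d2.fun_mul d2)) (d3.fun_mul d3),
        D_add i (d1.fun_mul d1) (d2.fun_mul d2), D_mul i d1 d1, D_mul i d2 d2, D_mul i d3 d3,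
        P.dA i x hx, P.dB i x hx, P.dw i x hx]
      ring
    simp only [Pi.sub_apply, Da, DG, D_const, bil]
    refine h.trans (le_of_eq ?_)
    ring)
  have eF := integral_add (F.int'.sub T.int')
      (iG.const_mul ((2 * c + (12 * c + 16000) ^ 2 / 2) / r ^ 2))
  have eF2 := integral_sub F.int' T.int'
  have eG := integral_const_mul (μ := volume.restrict Ω)
    ((2 * c + (12 * c + 16000) ^ 2 / 2) / r ^ 2) (fun x => e1 x ^ 2 + e2 x ^ 2 + om x ^ 2)
  have eQ := integral_const_mul (μ := volume.restrict Ω) (1/2:ℝ) (fun x =>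
    A 0 x ^ 2 + A 1 x ^ 2 + B 0 x ^ 2 + B 1 x ^ 2 + w 0 x ^ 2 + w 1 x ^ 2)
  rw [eQ] at mono
  have mono' := mono.trans (eF.trans_le (by rw [eG]))
  simp only [Pi.sub_apply] at mono' eF2
  rw [eF2] at mono'
  linarith

end

end

section

section
variable {Ω : Set E2} {r : ℝ} {ν : E2 → E2} {u : E2 → E2}

/-- components of iterated derivatives -/
def J (u : E2 → E2) (n : ℕ) (m : Fin n → E2) (i : Fin 2) (x : E2) : ℝ := (iteratedFDeriv ℝ n u x m) i

lemma J_ct {S : Set E2} {n : ℕ} (h : ContinuousOn (iteratedFDeriv ℝ n u) S) (m : Fin n → E2)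
    (i : Fin 2) : ContinuousOn (J u n m i) S := by
  have h1 : ContinuousOn (fun x => iteratedFDeriv ℝ n u x m) S :=
    (ContinuousMultilinearMap.apply ℝ (fun _ : Fin n => E2) E2 m).continuous.comp_continuousOn h
  exact (EuclideanSpace.proj (𝕜 := ℝ) i).continuous.comp_continuousOn h1

lemma J_cd (hΩ : IsOpen Ω) {n l N : ℕ} (hu : ContDiffOn ℝ N u Ω) (hN : l + n ≤ N) (m : Fin n → E2)
    (i : Fin 2) : ContDiffOn ℝ l (J u n m i) Ω := by
  intro x hx
  have h0 : ContDiffAt ℝ N u x := hu.contDiffAt (hΩ.mem_nhds hx)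
  have h1 : ContDiffAt ℝ l (iteratedFDeriv ℝ n u) x := h0.iteratedFDeriv_right (by exact_mod_cast hN)
  have h2 := (((EuclideanSpace.proj (𝕜 := ℝ) i).comp
    (ContinuousMultilinearMap.apply ℝ (fun _ : Fin n => E2) E2 m)).contDiff.contDiffAt).comp x h1
  exact h2.contDiffWithinAt

lemma J_D (hΩ : IsOpen Ω) {n N : ℕ} (hu : ContDiffOn ℝ N u Ω) (hN : 1 + n ≤ N) (m : Fin n → E2)
    (i l : Fin 2) {x : E2} (hx : x ∈ Ω) :
    D l (J u n m i) x = J u (n+1) (Fin.cons (e l) m) i x := by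
  have h0 : ContDiffAt ℝ N u x := hu.contDiffAt (hΩ.mem_nhds hx)
  have h1 : ContDiffAt ℝ 1 (iteratedFDeriv ℝ n u) x := h0.iteratedFDeriv_right (by exact_mod_cast hN)
  have h2 := ((EuclideanSpace.proj (𝕜 := ℝ) i).comp
    (ContinuousMultilinearMap.apply ℝ (fun _ : Fin n => E2) E2 m)).hasFDerivAt.comp x
      (h1.differentiableAt one_ne_zero).hasFDerivAt
  have h3 : fderiv ℝ (J u n m i) x = _ := h2.fderiv
  unfold D J
  rw [iteratedFDeriv_succ_apply_left]
  unfold J at h3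
  rw [h3]
  simp

lemma J_good (G : Geo Ω r ν) {n N : ℕ} (hu : ContDiffOn ℝ N u Ω) (hN : 1 + n ≤ N)
    (hc : ContinuousOn (iteratedFDeriv ℝ n u) (closure Ω))
    (hc' : ContinuousOn (iteratedFDeriv ℝ (n+1) u) (closure Ω)) (m : Fin n → E2) (i : Fin 2) :
    Good Ω (J u n m i) := by
  refine ⟨J_cd G.op hu hN m i, J_ct hc m i, fun l => ?_⟩
  obtain ⟨M, -, hM⟩ := G.bdd (J_ct hc' (Fin.cons (e l) m) i)
  exact ⟨M, fun x hx => by rw [J_D G.op hu hN m i l hx]; exact hM x (subset_closure hx)⟩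

lemma D_symm (hΩ : IsOpen Ω) {f : E2 → ℝ} (hf : ContDiffOn ℝ 2 f Ω) (i j : Fin 2) {x : E2}
    (hx : x ∈ Ω) : D i (D j f) x = D j (D i f) x := by
  have h0 : ContDiffAt ℝ 2 f x := hf.contDiffAt (hΩ.mem_nhds hx)
  have h1 : DifferentiableAt ℝ (fderiv ℝ f) x :=
    (h0.fderiv_right (m := 1) (by norm_num)).differentiableAt one_ne_zero
  have hs : IsSymmSndFDerivAt ℝ f x := h0.isSymmSndFDerivAt (by simp)
  have k : ∀ i j, D i (D j f) x = fderiv ℝ (fderiv ℝ f) x (e i) (e j) := by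
    intro i j
    have h2 := (ContinuousLinearMap.apply ℝ ℝ (e j)).hasFDerivAt.comp x h1.hasFDerivAt
    have h3 : fderiv ℝ (D j f) x = _ := h2.fderiv
    unfold D at *
    rw [h3]; simp
  rw [k, k, hs]

lemma J2_symm (hΩ : IsOpen Ω) (hu : ContDiffOn ℝ 3 u Ω) (a b : E2) (i : Fin 2) {x : E2}
    (hx : x ∈ Ω) : J u 2 ![a, b] i x = J u 2 ![b, a] i x := by
  have h0 : ContDiffAt ℝ 3 u x := hu.contDiffAt (hΩ.mem_nhds hx)
  have hs : IsSymmSndFDerivAt ℝ u x := h0.isSymmSndFDerivAt (by simp; norm_num)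
  unfold J
  rw [iteratedFDeriv_two_apply, iteratedFDeriv_two_apply]
  simp [hs a b]

lemma D_congr (hΩ : IsOpen Ω) {f g : E2 → ℝ} (h : ∀ x ∈ Ω, f x = g x) (i : Fin 2) {x : E2}
    (hx : x ∈ Ω) : D i f x = D i g x := by
  unfold D
  have : f =ᶠ[𝓝 x] g := by filter_upwards [hΩ.mem_nhds hx] with y hy using h y hy
  rw [this.fderiv_eq]

lemma gradEntry_J (x : E2) (i j : Fin 2) : gradEntry u x i j = J u 1 ![e j] i x := by
  unfold gradEntry J
  rw [inner_e, iteratedFDeriv_one_apply]; simp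

end

end

section

section
variable {Ω : Set E2} {r : ℝ} {ν : E2 → E2} {u : E2 → E2}

def Ea (u : E2 → E2) (x : E2) : ℝ := J u 1 ![e 0] 0 x
def Eb (u : E2 → E2) (x : E2) : ℝ := (1/2) * (J u 1 ![e 0] 1 x + J u 1 ![e 1] 0 x)
def Om (u : E2 → E2) (x : E2) : ℝ := J u 1 ![e 0] 1 x - J u 1 ![e 1] 0 x
def Aa (u : E2 → E2) (i : Fin 2) (x : E2) : ℝ := J u 2 ![e i, e 0] 0 x
def Bb (u : E2 → E2) (i : Fin 2) (x : E2) : ℝ :=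
  (1/2) * (J u 2 ![e i, e 0] 1 x + J u 2 ![e i, e 1] 0 x)
def Ww (u : E2 → E2) (i : Fin 2) (x : E2) : ℝ := J u 2 ![e i, e 0] 1 x - J u 2 ![e i, e 1] 0 x

lemma div_J (x : E2) : divg u x = J u 1 ![e 0] 0 x + J u 1 ![e 1] 1 x := by
  unfold divg
  rw [Fin.sum_univ_two, ← gradEntry_J, ← gradEntry_J]; rfl

lemma lap_J (x : E2) (i : Fin 2) : vLap u x i = J u 2 ![e 0, e 0] i x + J u 2 ![e 1, e 1] i x := by
  unfold vLap J
  rw [Fin.sum_univ_two, iteratedFDeriv_two_apply, iteratedFDeriv_two_apply]; simp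

lemma gradv_apply (f : E2 → ℝ) (x : E2) (i : Fin 2) : gradv f x i = D i f x := by
  unfold gradv D
  rw [Fin.sum_univ_two]
  fin_cases i <;> simp [e_apply]

lemma div2 (hΩ : IsOpen Ω) (hu : ContDiffOn ℝ 3 u Ω) (hdiv : ∀ x ∈ Ω, divg u x = 0) (i : Fin 2)
    {x : E2} (hx : x ∈ Ω) : J u 2 ![e i, e 0] 0 x + J u 2 ![e i, e 1] 1 x = 0 := by
  have h := D_congr hΩ (f := fun x => J u 1 ![e 0] 0 x + J u 1 ![e 1] 1 x) (g := fun _ => 0)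
    (fun y hy => by rw [← div_J]; exact hdiv y hy) i hx
  have cd : ∀ j k, DifferentiableAt ℝ (J u 1 ![e j] k) x := fun j k =>
    ((J_cd hΩ (l := 1) (N := 3) hu (by norm_num) ![e j] k).contDiffAt
      (hΩ.mem_nhds hx)).differentiableAt one_ne_zero
  rw [D_const, D_add i (cd 0 0) (cd 1 1), J_D hΩ (N := 3) hu (by norm_num) _ _ _ hx,
    J_D hΩ (N := 3) hu (by norm_num) _ _ _ hx] at h
  exact h

lemma press (hΩ : IsOpen Ω) (hu : ContDiffOn ℝ 3 u Ω) (hdiv : ∀ x ∈ Ω, divg u x = 0)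
    {ϑ : ℝ} {p : E2 → ℝ} (hst : ∀ x ∈ Ω, ϑ • vLap u x = gradv p x)
    {x : E2} (hx : x ∈ Ω) : D 0 p x = -(ϑ * Ww u 1 x) ∧ D 1 p x = ϑ * Ww u 0 x := by
  have k0 := congrArg (fun v : E2 => v 0) (hst x hx)
  have k1 := congrArg (fun v : E2 => v 1) (hst x hx)
  simp only [PiLp.smul_apply, smul_eq_mul, lap_J, gradv_apply] at k0 k1
  have d0 := div2 hΩ hu hdiv 0 hx
  have d1 := div2 hΩ hu hdiv 1 hx
  have s0 := J2_symm hΩ hu (e 0) (e 1) 0 hx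
  have s1 := J2_symm hΩ hu (e 0) (e 1) 1 hx
  unfold Ww
  constructor
  · linear_combination -k0 + ϑ * d0 - ϑ * s1
  · linear_combination -k1 + ϑ * d1 + ϑ * s0

lemma mkPDE (G : Geo Ω r ν) (hu : ContDiffOn ℝ 3 u Ω)
    (c1 : ContinuousOn (iteratedFDeriv ℝ 1 u) (closure Ω))
    (c2 : ContinuousOn (iteratedFDeriv ℝ 2 u) (closure Ω))
    (c3 : ContinuousOn (iteratedFDeriv ℝ 3 u) (closure Ω))
    (hdiv : ∀ x ∈ Ω, divg u x = 0) {ϑ : ℝ} (hϑ : 0 < ϑ) {p : E2 → ℝ} (hp : ContDiffOn ℝ 2 p Ω)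
    (hst : ∀ x ∈ Ω, ϑ • vLap u x = gradv p x) :
    PDE Ω (Ea u) (Eb u) (Om u) (Aa u) (Bb u) (Ww u) := by
  have g1 : ∀ j k, Good Ω (J u 1 ![e j] k) := fun j k =>
    J_good G (N := 3) hu (by norm_num) c1 c2 _ _
  have g2 : ∀ i j k, Good Ω (J u 2 ![e i, e j] k) := fun i j k =>
    J_good G (N := 3) hu (by norm_num) c2 c3 _ _
  have d1 : ∀ i j k, ∀ x ∈ Ω, D i (J u 1 ![e j] k) x = J u 2 ![e i, e j] k x := fun i j k x hx =>
    J_D G.op (N := 3) hu (by norm_num) _ _ _ hx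
  have gEa : Good Ω (Ea u) := g1 0 0
  have gEb : Good Ω (Eb u) := ((g1 0 1).add G (g1 1 0)).smul G (1/2)
  have gOm : Good Ω (Om u) := (g1 0 1).sub G (g1 1 0)
  have gA : ∀ i, Good Ω (Aa u i) := fun i => g2 i 0 0
  have gB : ∀ i, Good Ω (Bb u i) := fun i => ((g2 i 0 1).add G (g2 i 1 0)).smul G (1/2)
  have gW : ∀ i, Good Ω (Ww u i) := fun i => (g2 i 0 1).sub G (g2 i 1 0)
  have dA : ∀ i, ∀ x ∈ Ω, D i (Ea u) x = Aa u i x := fun i x hx => d1 i 0 0 x hx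
  have dB : ∀ i, ∀ x ∈ Ω, D i (Eb u) x = Bb u i x := fun i x hx => by
    have h1 := (g1 0 1).diff G.op hx
    have h2 := (g1 1 0).diff G.op hx
    unfold Eb Bb
    rw [D_mul i (differentiableAt_const _) (h1.fun_add h2), D_const, D_add i h1 h2,
      d1 i 0 1 x hx, d1 i 1 0 x hx]
    ring
  have dW : ∀ i, ∀ x ∈ Ω, D i (Om u) x = Ww u i x := fun i x hx => by
    have h1 := (g1 0 1).diff G.op hx
    have h2 := (g1 1 0).diff G.op hx
    unfold Om Ww
    rw [D_sub i h1 h2, d1 i 0 1 x hx, d1 i 1 0 x hx]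
  have cdJ : ∀ j k, ContDiffOn ℝ 2 (J u 1 ![e j] k) Ω := fun j k =>
    J_cd G.op (l := 2) (N := 3) hu (by norm_num) _ _
  have sy : ∀ {f : E2 → ℝ} {a : Fin 2 → E2 → ℝ}, ContDiffOn ℝ 2 f Ω →
      (∀ i, ∀ x ∈ Ω, D i f x = a i x) → ∀ x ∈ Ω, D 0 (a 1) x = D 1 (a 0) x := by
    intro f a hf ha x hx
    rw [← D_congr G.op (ha 1) 0 hx, ← D_congr G.op (ha 0) 1 hx]
    exact D_symm G.op hf 0 1 hx
  have cEb : ContDiffOn ℝ 2 (Eb u) Ω := contDiffOn_const.mul ((cdJ 0 1).add (cdJ 1 0))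
  have cOm : ContDiffOn ℝ 2 (Om u) Ω := (cdJ 0 1).sub (cdJ 1 0)
  refine ⟨gEa, gEb, gOm, gA, gB, gW, dA, dB, dW, ?_, ?_, ?_, sy (cdJ 0 0) dA, sy cEb dB, sy cOm dW⟩
  · intro x hx
    have d0 := div2 G.op hu hdiv 0 hx
    have s1 := J2_symm G.op hu (e 0) (e 1) 1 hx
    unfold Aa Bb Ww
    linear_combination d0 - s1
  · intro x hx
    have s0 := J2_symm G.op hu (e 0) (e 1) 0 hx
    unfold Aa Bb Ww
    linear_combination s0
  · intro x hx
    have pr := fun y hy => press (x := y) G.op hu hdiv hst hy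
    have h := sy hp (a := ![fun y => -(ϑ * Ww u 1 y), fun y => ϑ * Ww u 0 y]) (fun i y hy => by
      fin_cases i
      · exact (pr y hy).1
      · exact (pr y hy).2) x hx
    simp only [Matrix.cons_val_zero, Matrix.cons_val_one] at h
    have e1 : D 0 (fun y => ϑ * Ww u 0 y) x = ϑ * D 0 (Ww u 0) x := by
      rw [D_mul 0 (differentiableAt_const ϑ) ((gW 0).diff G.op hx), D_const]; ring
    have e2 : D 1 (fun y => -(ϑ * Ww u 1 y)) x = -(ϑ * D 1 (Ww u 1) x) := by
      have : (fun y => -(ϑ * Ww u 1 y)) = (fun y => (-ϑ) * Ww u 1 y) := by ext y; ring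
      rw [this, D_mul 1 (differentiableAt_const _) ((gW 1).diff G.op hx), D_const]; ring
    rw [e1, e2] at h
    have : ϑ * (D 0 (Ww u 0) x + D 1 (Ww u 1) x) = 0 := by linarith
    exact (mul_eq_zero.1 this).resolve_left hϑ.ne'

end

end

section

section
variable {Ω : Set E2} {r : ℝ} {ν : E2 → E2} {u : E2 → E2}

lemma Geo.seq (G : Geo Ω r ν) {x : E2} (hx : x ∈ frontier Ω) : ∃ (c : ℕ → ℝ) (d : ℕ → E2),
    (∀ n, x + d n ∈ frontier Ω) ∧ Tendsto d atTop (𝓝 0) ∧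
      Tendsto (fun n => c n • d n) atTop (𝓝 (rot (ν x))) := by
  have hr := G.rpos
  have ht : ∀ n : ℕ, 0 < r / ((n:ℝ) + 2) ∧ r / ((n:ℝ) + 2) < r := fun n => by
    refine ⟨by positivity, ?_⟩
    rw [div_lt_iff₀ (by positivity)]
    have : (0:ℝ) ≤ n := by positivity
    nlinarith
  choose s hs hs' using fun n : ℕ => G.cross hx (t := r / ((n:ℝ) + 2))
    (by rw [abs_of_pos (ht n).1]; exact (ht n).2)
  have t0 : Tendsto (fun n : ℕ => r / ((n:ℝ) + 2)) atTop (𝓝 0) := by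
    apply Tendsto.const_div_atTop
    exact tendsto_atTop_add_const_right _ _ tendsto_natCast_atTop_atTop
  set t : ℕ → ℝ := fun n => r / ((n:ℝ) + 2) with htd
  have q0 : Tendsto (fun n => (t n)⁻¹ * s n) atTop (𝓝 0) := by
    have : Tendsto (fun n => t n / r) atTop (𝓝 0) := by simpa using t0.div_const r
    refine squeeze_zero_norm (fun n => ?_) this
    have h1 := hs n
    have h2 := (ht n).1
    rw [Real.norm_eq_abs, abs_mul, abs_of_pos (inv_pos.2 h2)]
    calc (t n)⁻¹ * |s n| ≤ (t n)⁻¹ * ((t n) ^ 2 / r) := by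
          have := inv_pos.2 h2
          exact mul_le_mul_of_nonneg_left h1 this.le
      _ = t n / r := by
          have : t n ≠ 0 := h2.ne'
          field_simp
  have cd : Tendsto (fun n => (t n)⁻¹ • (t n • rot (ν x) + s n • ν x)) atTop (𝓝 (rot (ν x))) := by
    have e : (fun n => (t n)⁻¹ • (t n • rot (ν x) + s n • ν x)) =
        fun n => rot (ν x) + ((t n)⁻¹ * s n) • ν x := by
      ext1 n
      have : t n ≠ 0 := (ht n).1.ne'
      rw [smul_add, smul_smul, smul_smul, inv_mul_cancel₀ this, one_smul]
    rw [e]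
    simpa using tendsto_const_nhds.add (q0.smul_const (ν x))
  refine ⟨fun n => (t n)⁻¹, fun n => t n • rot (ν x) + s n • ν x, fun n => ?_, ?_, cd⟩
  · rw [← add_assoc]; exact hs' n
  · have := t0.smul cd
    rw [zero_smul] at this
    refine this.congr (fun n => ?_)
    have : t n ≠ 0 := (ht n).1.ne'
    rw [smul_smul, mul_inv_cancel₀ this, one_smul]

/-- tangential derivative along a sequence -/
def TD (c : ℕ → ℝ) (d : ℕ → E2) (x : E2) (f : E2 → ℝ) (a : ℝ) : Prop :=
  Tendsto (fun n => c n * (f (x + d n) - f x)) atTop (𝓝 a) ∧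
    Tendsto (fun n => f (x + d n)) atTop (𝓝 (f x))

section TD
variable {c : ℕ → ℝ} {d : ℕ → E2} {x : E2} {f g : E2 → ℝ} {a b : ℝ}

lemma TD.add (hf : TD c d x f a) (hg : TD c d x g b) : TD c d x (fun y => f y + g y) (a + b) :=
  ⟨(hf.1.add hg.1).congr (fun n => by ring), hf.2.add hg.2⟩

lemma TD.mul (hf : TD c d x f a) (hg : TD c d x g b) :
    TD c d x (fun y => f y * g y) (a * g x + f x * b) := by
  refine ⟨?_, hf.2.mul hg.2⟩
  have := (hf.1.mul hg.2).add (hg.1.const_mul (f x))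
  rw [mul_comm (f x) b]
  rw [mul_comm (f x) b] at this
  exact this.congr (fun n => by ring)

lemma TD.const (k : ℝ) : TD c d x (fun _ => k) 0 :=
  ⟨by simp, tendsto_const_nhds⟩

lemma TD.smul (k : ℝ) (hf : TD c d x f a) : TD c d x (fun y => k * f y) (k * a) :=
  ⟨(hf.1.const_mul k).congr (fun n => by ring), hf.2.const_mul k⟩

lemma TD.zero (hf : TD c d x f a) (h : ∀ n, f (x + d n) = 0) (hx : f x = 0) : a = 0 := by
  have := hf.1
  simp only [h, hx, sub_zero, mul_zero] at this
  exact tendsto_nhds_unique this tendsto_const_nhds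

lemma TD.of {S : Set E2} {L : E2 →L[ℝ] ℝ} {v : E2} (hf : HasFDerivWithinAt f L S x)
    (hd : ∀ n, x + d n ∈ S) (d0 : Tendsto d atTop (𝓝 0))
    (cd : Tendsto (fun n => c n • d n) atTop (𝓝 v)) : TD c d x f (L v) := by
  refine ⟨by simpa using hf.lim d0 (Eventually.of_forall hd) cd, ?_⟩
  have : Tendsto (fun n => x + d n) atTop (𝓝[S] x) := by
    rw [tendsto_nhdsWithin_iff]
    exact ⟨by simpa using tendsto_const_nhds.add d0, Eventually.of_forall hd⟩
  exact hf.continuousWithinAt.tendsto.comp this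

end TD

lemma Geo.udiff (G : Geo Ω r ν) : UniqueDiffOn ℝ (closure Ω) := by
  intro x hx
  have hr := G.rpos
  by_cases h : x ∈ Ω
  · exact ((G.op.uniqueDiffOn) x h).mono subset_closure
  · have hf : x ∈ frontier Ω := by rw [G.op.frontier_eq]; exact ⟨hx, h⟩
    have h1 : UniqueDiffWithinAt ℝ (ball (x - r • ν x) r) x := by
      apply uniqueDiffWithinAt_convex (convex_ball _ _)
      · rw [isOpen_ball.interior_eq]; exact nonempty_ball.2 hr
      · rw [closure_ball _ hr.ne', mem_closedBall, dist_eq_norm]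
        simp [norm_smul, G.unit x hf, abs_of_pos hr]
    exact h1.mono ((G.inn x hf).trans subset_closure)

lemma lin_two (L : E2 →L[ℝ] ℝ) (v : E2) : L v = v 0 * L (e 0) + v 1 * L (e 1) := by
  conv_lhs => rw [eq_sum_e v]
  simp

lemma Geo.bder (G : Geo Ω r ν) {f : E2 → ℝ} (hf : ContDiffOn ℝ 1 f (closure Ω))
    {a : Fin 2 → E2 → ℝ} (ha : ∀ i, ContinuousOn (a i) (closure Ω))
    (h : ∀ i, ∀ x ∈ Ω, D i f x = a i x) {x : E2} (hx : x ∈ frontier Ω) {c : ℕ → ℝ} {d : ℕ → E2}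
    (hd : ∀ n, x + d n ∈ frontier Ω) (d0 : Tendsto d atTop (𝓝 0))
    (cd : Tendsto (fun n => c n • d n) atTop (𝓝 (rot (ν x)))) :
    TD c d x f (ν x 0 * a 1 x - ν x 1 * a 0 x) := by
  have hxc := frontier_subset_closure hx
  have h1 : HasFDerivWithinAt f (fderivWithin ℝ f (closure Ω) x) (closure Ω) x :=
    (hf.differentiableOn one_ne_zero x hxc).hasFDerivWithinAt
  have h2 : ∀ i, fderivWithin ℝ f (closure Ω) x (e i) = a i x := by
    intro i
    have hc : ContinuousOn (fun y => fderivWithin ℝ f (closure Ω) y (e i)) (closure Ω) :=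
      (hf.continuousOn_fderivWithin G.udiff le_rfl).clm_apply continuousOn_const
    refine Set.EqOn.of_subset_closure (s := Ω) (fun y hy => ?_) hc (ha i) subset_closure le_rfl hxc
    rw [← h i y hy, fderivWithin_of_mem_nhds
      (mem_of_superset (G.op.mem_nhds hy) subset_closure)]
    rfl
  have h3 := TD.of h1 (fun n => frontier_subset_closure (hd n)) d0 cd
  rw [lin_two, h2, h2, rot_0, rot_1] at h3
  convert h3 using 1
  ring

lemma J1_reg (G : Geo Ω r ν) (hu : ContDiffOn ℝ 3 u (closure Ω))
    (c1 : ContinuousOn (iteratedFDeriv ℝ 1 u) (closure Ω)) (v : E2) (i : Fin 2) :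
    ContDiffOn ℝ 1 (J u 1 ![v] i) (closure Ω) := by
  have h1 : ContDiffOn ℝ 1 (fderivWithin ℝ u (closure Ω)) (closure Ω) :=
    hu.fderivWithin G.udiff (by norm_num)
  have h2 : ContDiffOn ℝ 1 (fun x => (fderivWithin ℝ u (closure Ω) x v) i) (closure Ω) :=
    (EuclideanSpace.proj (𝕜 := ℝ) i).contDiff.comp_contDiffOn (h1.clm_apply contDiffOn_const)
  refine h2.congr ?_
  refine Set.EqOn.of_subset_closure (s := Ω) (fun y hy => ?_) (J_ct c1 _ i) h2.continuousOn
    subset_closure le_rfl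
  simp only
  rw [fderivWithin_of_mem_nhds (mem_of_superset (G.op.mem_nhds hy) subset_closure)]
  unfold J
  rw [iteratedFDeriv_one_apply]
  simp

end

end

section
section
variable {Ω : Set E2} {r : ℝ} {ν : E2 → E2} {u : E2 → E2}

lemma div_cl (c1 : ContinuousOn (iteratedFDeriv ℝ 1 u) (closure Ω))
    (hdiv : ∀ x ∈ Ω, divg u x = 0) {x : E2} (hx : x ∈ closure Ω) :
    J u 1 ![e 0] 0 x + J u 1 ![e 1] 1 x = 0 := by
  have h : ContinuousOn (fun x => J u 1 ![e 0] 0 x + J u 1 ![e 1] 1 x) (closure Ω) :=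
    (J_ct c1 _ 0).add (J_ct c1 _ 1)
  exact Set.EqOn.of_subset_closure (s := Ω) (g := fun _ => (0:ℝ))
    (fun y hy => by rw [← div_J]; exact hdiv y hy) h continuousOn_const subset_closure le_rfl hx

lemma bc_comp (c1 : ContinuousOn (iteratedFDeriv ℝ 1 u) (closure Ω))
    (hdiv : ∀ x ∈ Ω, divg u x = 0) {κ p ϑ : ℝ} (hϑ : 0 < ϑ) {x n : E2} (hn : n 0 ^2 + n 1 ^ 2 = 1)
    (hx : x ∈ closure Ω)
    (bc : κ • n = p • n - (2*ϑ) • symGradApp u x n) :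
    (n 0^2 - n 1^2) * Eb u x + (-2) * (n 0 * n 1 * Ea u x) = 0 ∧
    κ + (-1) * p + (2*ϑ) * ((n 0^2 - n 1^2) * Ea u x + 2 * (n 0 * n 1 * Eb u x)) = 0 := by
  have hd := div_cl c1 hdiv hx
  have k0 := congrArg (fun v : E2 => v 0) bc
  have k1 := congrArg (fun v : E2 => v 1) bc
  simp only [symGradApp, Fin.sum_univ_two, symGradEntry, gradEntry_J, inner_e, PiLp.smul_apply,
    PiLp.sub_apply, PiLp.add_apply, e_apply, smul_eq_mul] at k0 k1
  simp only [Fin.isValue, if_true, if_false, one_ne_zero, zero_ne_one, mul_one, mul_zero, add_zero, zero_add] at k0 k1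
  have hE : Ea u x = J u 1 ![e 0] 0 x := rfl
  have hE' : J u 1 ![e 1] 1 x = - Ea u x := by rw [hE]; linarith
  have hb : J u 1 ![e 1] 0 x = 2 * Eb u x - J u 1 ![e 0] 1 x := by unfold Eb; ring
  rw [← hE, hb] at k0
  rw [hE', hb] at k1
  constructor
  · have : (2*ϑ) * ((n 0^2 - n 1^2) * Eb u x + (-2) * (n 0 * n 1 * Ea u x)) = 0 := by
      linear_combination n 0 * k1 - n 1 * k0
    rcases mul_eq_zero.1 this with h | h
    · linarith
    · exact h
  · linear_combination n 0 * k0 + n 1 * k1 + (p - κ) * hn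

lemma norm_le_seq (G : Geo Ω r ν) {x : E2} (hx : x ∈ frontier Ω) (hν : DifferentiableAt ℝ ν x) :
    ‖fderiv ℝ ν x (rot (ν x))‖ ≤ 1 / r := by
  obtain ⟨c, d, hd, d0, cd⟩ := G.seq hx
  have h1 := hν.hasFDerivAt.hasFDerivWithinAt.lim (s := frontier Ω) d0 (Eventually.of_forall hd) cd
  have h2 := cd.norm.div_const r
  rw [norm_rot, G.unit x hx] at h2
  refine le_of_tendsto_of_tendsto' h1.norm h2 (fun n => ?_)
  rw [norm_smul, norm_smul, mul_div_assoc]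
  have := G.lip (hd n) hx
  rw [add_sub_cancel_left] at this
  exact mul_le_mul_of_nonneg_left this (norm_nonneg _)

lemma TD_comp {c : ℕ → ℝ} {d : ℕ → E2} {x v : E2} (hν : DifferentiableAt ℝ ν x) (i : Fin 2)
    (d0 : Tendsto d atTop (𝓝 0)) (cd : Tendsto (fun n => c n • d n) atTop (𝓝 v)) :
    TD c d x (fun y => ν y i) ((fderiv ℝ ν x v) i) := by
  have h : HasFDerivAt (fun y => ν y i) ((EuclideanSpace.proj (𝕜 := ℝ) i).comp (fderiv ℝ ν x)) x :=
    (EuclideanSpace.proj (𝕜 := ℝ) i).hasFDerivAt.comp x hν.hasFDerivAt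
  exact TD.of (S := univ) h.hasFDerivWithinAt (fun _ => mem_univ _) d0 cd

lemma bdry (G : Geo Ω r ν) (hu : ContDiffOn ℝ 3 u (closure Ω))
    (c1 : ContinuousOn (iteratedFDeriv ℝ 1 u) (closure Ω))
    (c2 : ContinuousOn (iteratedFDeriv ℝ 2 u) (closure Ω))
    (hdiv : ∀ x ∈ Ω, divg u x = 0) {ϑ : ℝ} (hϑ : 0 < ϑ) {p κ : E2 → ℝ}
    (hp : ContDiffOn ℝ 2 p (closure Ω))
    (hst : ∀ x ∈ Ω, ϑ • vLap u x = gradv p x)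
    (P : PDE Ω (Ea u) (Eb u) (Om u) (Aa u) (Bb u) (Ww u))
    (hν : ∀ x ∈ frontier Ω, DifferentiableAt ℝ ν x)
    (hκ : ∀ x ∈ frontier Ω, DifferentiableAt ℝ κ x)
    (kap : ∀ x ∈ frontier Ω, κ x = ⟪fderiv ℝ ν x (rot (ν x)), rot (ν x)⟫)
    (bc : ∀ x ∈ frontier Ω, κ x • ν x = p x • ν x - (2*ϑ) • symGradApp u x (ν x))
    {x : E2} (hx : x ∈ frontier Ω) :
    (ν x 0^2 - ν x 1^2) * Eb u x = 2*ν x 0*ν x 1*Ea u x ∧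
    (Ww u 0 x*ν x 0 + Ww u 1 x*ν x 1) - 2*((ν x 0^2 - ν x 1^2)*(ν x 0*Aa u 1 x - ν x 1*Aa u 0 x)
      + 2*ν x 0*ν x 1*(ν x 0*Bb u 1 x - ν x 1*Bb u 0 x)) = fderiv ℝ κ x (rot (ν x)) / ϑ ∧
    Eb u x*(ν x 0*Aa u 1 x - ν x 1*Aa u 0 x) - Ea u x*(ν x 0*Bb u 1 x - ν x 1*Bb u 0 x)
      ≤ 2/r*(Ea u x^2+Eb u x^2) := by
  have hr := G.rpos
  have hn : ∀ y ∈ frontier Ω, ν y 0 ^ 2 + ν y 1 ^ 2 = 1 := fun y hy => by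
    rw [← norm_sq_two, G.unit y hy]; norm_num
  have hbc := fun y (hy : y ∈ frontier Ω) =>
    bc_comp c1 hdiv hϑ (hn y hy) (frontier_subset_closure hy) (bc y hy)
  obtain ⟨c, d, hd, d0, cd⟩ := G.seq hx
  have t0 := TD_comp (hν x hx) 0 d0 cd
  have t1 := TD_comp (hν x hx) 1 d0 cd
  have hk := kap x hx
  have hkr : |κ x| ≤ 1 / r := by
    rw [hk]
    refine (abs_real_inner_le_norm _ _).trans ?_
    rw [norm_rot, G.unit x hx, mul_one]
    exact norm_le_seq G hx (hν x hx)
  rw [inner_two, rot_0, rot_1] at hk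
  have tk : TD c d x κ (fderiv ℝ κ x (rot (ν x))) :=
    TD.of (S := univ) (hκ x hx).hasFDerivAt.hasFDerivWithinAt (fun _ => mem_univ _) d0 cd
  have tp := G.bder (hp.of_le (by norm_num)) (a := fun i => if i = 0 then fun y => -(ϑ * Ww u 1 y) else fun y => ϑ * Ww u 0 y)
    (fun i => by
      split_ifs
      · exact ((P.gw 1).ct.const_smul ϑ).neg
      · exact (P.gw 0).ct.const_smul ϑ)
    (fun i y hy => by
      have := press G.op (hu.mono subset_closure) hdiv hst hy
      fin_cases i
      · simpa using this.1
      · simpa using this.2) hx hd d0 cd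
  simp only [one_ne_zero, if_true, if_false] at tp
  have rEa : ContDiffOn ℝ 1 (Ea u) (closure Ω) := J1_reg G hu c1 _ _
  have rEb : ContDiffOn ℝ 1 (Eb u) (closure Ω) :=
    contDiffOn_const.mul ((J1_reg G hu c1 _ _).add (J1_reg G hu c1 _ _))
  have tA := G.bder rEa (fun i => (P.gA i).ct) P.dA hx hd d0 cd
  have tB := G.bder rEb (fun i => (P.gB i).ct) P.dB hx hd d0 cd
  set n0' := (fderiv ℝ ν x (rot (ν x))) 0 with hn0'
  set n1' := (fderiv ℝ ν x (rot (ν x))) 1 with hn1'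
  set A' := ν x 0*Aa u 1 x - ν x 1*Aa u 0 x with hA'
  set B' := ν x 0*Bb u 1 x - ν x 1*Bb u 0 x with hB'
  set k' := fderiv ℝ κ x (rot (ν x)) with hk'
  have sq0 := t0.mul t0
  have sq1 := t1.mul t1
  have z0 := ((sq0.add sq1).add (TD.const (-1))).zero
    (fun n => by have := hn _ (hd n); nlinarith) (by have := hn _ hx; nlinarith)
  have tb := sq0.add (sq1.smul (-1))
  have t01 := t0.mul t1
  have z1 := ((tb.mul tB).add ((t01.mul tA).smul (-2))).zero
    (fun n => by have := (hbc _ (hd n)).1; linarith) (by have := (hbc _ hx).1; linarith)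
  have z2 := ((tk.add (tp.smul (-1))).add
    (((tb.mul tA).add ((t01.mul tB).smul 2)).smul (2*ϑ))).zero
    (fun n => by have := (hbc _ (hd n)).2; linarith) (by have := (hbc _ hx).2; linarith)
  have m := (hbc x hx).1
  have hnx := hn x hx
  have q0 : n0' = -(κ x) * ν x 1 := by
    rw [hk]; linear_combination (-n0') * hnx + (1/2) * ν x 0 * z0
  have q1 : n1' = (κ x) * ν x 0 := by
    rw [hk]; linear_combination (-n1') * hnx + (1/2) * ν x 1 * z0
  simp only [q0, q1] at z1 z2
  clear_value n0' n1' A' B' k'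
  generalize ν x 0 = a at *
  generalize ν x 1 = b at *
  generalize Ea u x = p1 at *
  generalize Eb u x = p2 at *
  generalize κ x = q at *
  refine ⟨by linarith, ?_, ?_⟩
  · rw [eq_div_iff hϑ.ne']
    linear_combination -z2 + 4 * ϑ * q * m
  · obtain ⟨s, hs⟩ : ∃ s, s = (a^2-b^2)*p1 + 2*a*b*p2 := ⟨_, rfl⟩
    have h1 : p1 = s * (a^2-b^2) := by
      rw [hs]; linear_combination (-p1*(a^2+b^2+1)) * hnx - 2*a*b*m
    have h2 : p2 = s * (2*a*b) := by
      rw [hs]; linear_combination (-p2*(a^2+b^2+1)) * hnx + (a^2-b^2)*m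
    have key : p2*A' - p1*B' = -(2*q*(p1^2+p2^2)) := by
      have e1 : p2*A' - p1*B' = s*(2*a*b*A' - (a^2-b^2)*B') := by rw [h1, h2]; ring
      have e2 : p1^2+p2^2 = s * ((a^2-b^2)*p1+2*a*b*p2) := by
        conv_lhs => rw [sq, sq]
        nth_rewrite 1 [h1]
        nth_rewrite 2 [h2]
        ring
      rw [e1, e2]
      linear_combination (-s)*z1
    rw [key]
    have := (abs_le.1 hkr).1
    have h4 : 0 ≤ p1^2+p2^2 := by positivity
    have : -(1/r)*(p1^2+p2^2) ≤ q*(p1^2+p2^2) := mul_le_mul_of_nonneg_right (by linarith) h4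
    calc -(2*q*(p1^2+p2^2)) ≤ 2 * ((1/r)*(p1^2+p2^2)) := by linarith
      _ = _ := by ring

end

end

section
section
variable {Ω : Set E2} {r : ℝ} {ν : E2 → E2} {u : E2 → E2}

def QQ (u : E2 → E2) (x : E2) : ℝ :=
  Aa u 0 x^2 + Aa u 1 x^2 + Bb u 0 x^2 + Bb u 1 x^2 + Ww u 0 x^2 + Ww u 1 x^2

lemma hess_le (hΩ : IsOpen Ω) (hu : ContDiffOn ℝ 3 u Ω) (hdiv : ∀ x ∈ Ω, divg u x = 0)
    {x : E2} (hx : x ∈ Ω) : ‖iteratedFDeriv ℝ 2 u x‖^2 ≤ 144 * QQ u x := by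
  have hQ : 0 ≤ QQ u x := by unfold QQ; positivity
  set q := Real.sqrt (QQ u x) with hq
  have q0 : 0 ≤ q := Real.sqrt_nonneg _
  have hqq : q^2 = QQ u x := Real.sq_sqrt hQ
  have bA : ∀ i, |Aa u i x| ≤ q := fun i => by
    rw [hq]; apply Real.abs_le_sqrt; unfold QQ
    fin_cases i <;> simp only [Fin.isValue, Fin.zero_eta, Fin.mk_one] <;> nlinarith [sq_nonneg (Aa u 0 x), sq_nonneg (Aa u 1 x), sq_nonneg (Bb u 0 x), sq_nonneg (Bb u 1 x), sq_nonneg (Ww u 0 x), sq_nonneg (Ww u 1 x)]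
  have bB : ∀ i, |Bb u i x| ≤ q := fun i => by
    rw [hq]; apply Real.abs_le_sqrt; unfold QQ
    fin_cases i <;> simp only [Fin.isValue, Fin.zero_eta, Fin.mk_one] <;> nlinarith [sq_nonneg (Aa u 0 x), sq_nonneg (Aa u 1 x), sq_nonneg (Bb u 0 x), sq_nonneg (Bb u 1 x), sq_nonneg (Ww u 0 x), sq_nonneg (Ww u 1 x)]
  have bW : ∀ i, |Ww u i x| ≤ q := fun i => by
    rw [hq]; apply Real.abs_le_sqrt; unfold QQ
    fin_cases i <;> simp only [Fin.isValue, Fin.zero_eta, Fin.mk_one] <;> nlinarith [sq_nonneg (Aa u 0 x), sq_nonneg (Aa u 1 x), sq_nonneg (Bb u 0 x), sq_nonneg (Bb u 1 x), sq_nonneg (Ww u 0 x), sq_nonneg (Ww u 1 x)]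
  have bJ : ∀ i j k : Fin 2, |J u 2 ![e i, e j] k x| ≤ 3/2 * q := by
    intro i j k
    have hA := abs_le.1 (bA i)
    have hB := abs_le.1 (bB i)
    have hW := abs_le.1 (bW i)
    have dd := div2 hΩ hu hdiv i hx
    unfold Aa at hA
    unfold Bb at hB
    unfold Ww at hW
    rw [abs_le]
    fin_cases j <;> fin_cases k <;> simp only [Fin.isValue, Fin.zero_eta, Fin.mk_one] <;>
      constructor <;> linarith [hA.1, hA.2, hB.1, hB.2, hW.1, hW.2]
  have bN : ∀ i j : Fin 2, ‖fderiv ℝ (fderiv ℝ u) x (e i) (e j)‖ ≤ 3 * q := by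
    intro i j
    have h0 := bJ i j 0
    have h1 := bJ i j 1
    unfold J at h0 h1
    rw [iteratedFDeriv_two_apply] at h0 h1
    simp only [Matrix.cons_val_zero, Matrix.cons_val_one] at h0 h1
    refine abs_le_of_sq_le_sq' ?_ (by positivity) |>.2
    rw [norm_sq_two]
    have := sq_le_sq' (abs_le.1 h0).1 (abs_le.1 h0).2
    have := sq_le_sq' (abs_le.1 h1).1 (abs_le.1 h1).2
    nlinarith [sq_nonneg q]
  have hN : ‖iteratedFDeriv ℝ 2 u x‖ ≤ 12 * q := by
    refine ContinuousMultilinearMap.opNorm_le_bound (by positivity) (fun m => ?_)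
    rw [iteratedFDeriv_two_apply, Fin.prod_univ_two]
    set F := fderiv ℝ (fderiv ℝ u) x with hF
    have hexp : F (m 0) (m 1) = (m 0 0 * m 1 0) • F (e 0) (e 0) + (m 0 0 * m 1 1) • F (e 0) (e 1)
        + (m 0 1 * m 1 0) • F (e 1) (e 0) + (m 0 1 * m 1 1) • F (e 1) (e 1) := by
      conv_lhs => rw [eq_sum_e (m 0), eq_sum_e (m 1)]
      simp only [map_add, map_smul, ContinuousLinearMap.add_apply, ContinuousLinearMap.smul_apply,
        smul_add, smul_smul]
      module
    have hb : ∀ i j : Fin 2, ‖(m 0 i * m 1 j) • F (e i) (e j)‖ ≤ ‖m 0‖ * ‖m 1‖ * (3 * q) := by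
      intro i j
      rw [norm_smul, norm_mul]
      gcongr
      · exact abs_apply_le _ _
      · exact abs_apply_le _ _
      · exact bN i j
    rw [hexp]
    refine (norm_add_le _ _).trans ?_
    have h1 := norm_add_le ((m 0 0 * m 1 0) • F (e 0) (e 0) + (m 0 0 * m 1 1) • F (e 0) (e 1))
      ((m 0 1 * m 1 0) • F (e 1) (e 0))
    have h2 := norm_add_le ((m 0 0 * m 1 0) • F (e 0) (e 0)) ((m 0 0 * m 1 1) • F (e 0) (e 1))
    linarith [hb 0 0, hb 0 1, hb 1 0, hb 1 1]
  calc ‖iteratedFDeriv ℝ 2 u x‖^2 ≤ (12*q)^2 := pow_le_pow_left₀ (norm_nonneg _) hN 2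
    _ = 144 * q^2 := by ring
    _ = _ := by rw [hqq]

lemma grad_ge (x : E2) : Ea u x^2 + Eb u x^2 + Om u x^2 ≤ 3 * gradNormSq u x := by
  unfold gradNormSq Ea Eb Om
  simp only [Fin.sum_univ_two, gradEntry_J]
  nlinarith [sq_nonneg (J u 1 ![e 0] 0 x), sq_nonneg (J u 1 ![e 1] 1 x), sq_nonneg (J u 1 ![e 0] 1 x - J u 1 ![e 1] 0 x), sq_nonneg (J u 1 ![e 0] 1 x + J u 1 ![e 1] 0 x)]

def θ0 : ℝ := 1 / (288 * CH)
def c0 : ℝ := 16 / θ0 + 2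
def C0 : ℝ := 864 * (2*c0+(12*c0+16000)^2/2)

lemma C0_nonneg : 0 ≤ C0 := by
  have := CH_pos
  unfold C0 c0 θ0
  positivity

lemma final_geo (G : Geo Ω r ν) (hu : ContDiffOn ℝ 3 u (closure Ω))
    (c1 : ContinuousOn (iteratedFDeriv ℝ 1 u) (closure Ω))
    (c2 : ContinuousOn (iteratedFDeriv ℝ 2 u) (closure Ω))
    (c3 : ContinuousOn (iteratedFDeriv ℝ 3 u) (closure Ω))
    (hdiv : ∀ x ∈ Ω, divg u x = 0) {ϑ : ℝ} (hϑ : 0 < ϑ) {p κ : E2 → ℝ}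
    (hp : ContDiffOn ℝ 2 p (closure Ω))
    (hst : ∀ x ∈ Ω, ϑ • vLap u x = gradv p x)
    (hν : ∀ x ∈ frontier Ω, DifferentiableAt ℝ ν x)
    (hκ : ∀ x ∈ frontier Ω, DifferentiableAt ℝ κ x)
    (hκ' : ContinuousOn (fun x => fderiv ℝ κ x (rot (ν x))) (frontier Ω))
    (kap : ∀ x ∈ frontier Ω, κ x = ⟪fderiv ℝ ν x (rot (ν x)), rot (ν x)⟫)
    (bc : ∀ x ∈ frontier Ω, κ x • ν x = p x • ν x - (2*ϑ) • symGradApp u x (ν x)) :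
    ϑ^2 * derivSq 2 Ω u ≤ r * bInt Ω (fun x => (fderiv ℝ κ x (rot (ν x)))^2)
      + ϑ^2 * (C0 / r^2) * ∫ x in Ω, gradNormSq u x := by
  have P := mkPDE G (hu.mono subset_closure) c1 c2 c3 hdiv hϑ (hp.mono subset_closure) hst
  have B := fun x (hx : x ∈ frontier Ω) => bdry G hu c1 c2 hdiv hϑ hp hst P hν hκ kap bc hx
  have hCH := CH_pos
  have hr := G.rpos
  have hkc : ContinuousOn (fun x => (fderiv ℝ κ x (rot (ν x)) / ϑ)^2) (frontier Ω) :=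
    (hκ'.div_const ϑ).pow 2
  obtain ⟨g, hg⟩ := ContinuousMap.exists_restrict_eq (s := frontier Ω) isClosed_frontier
    ⟨(frontier Ω).restrict (fun x => (fderiv ℝ κ x (rot (ν x)) / ϑ)^2), hkc.restrict⟩
  have hg' : ∀ x ∈ frontier Ω, g x = (fderiv ℝ κ x (rot (ν x)) / ϑ)^2 := fun x hx =>
    congrArg (fun f => f ⟨x, hx⟩) hg
  have hK : ∀ x ∈ frontier Ω, max (g x) 0 = (fderiv ℝ κ x (rot (ν x)) / ϑ)^2 := fun x hx => by
    rw [hg' x hx]; exact max_eq_left (sq_nonneg _)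
  have θpos : 0 < θ0 := by unfold θ0; positivity
  have main := core G P (k := fun x => fderiv ℝ κ x (rot (ν x)) / ϑ) (K := fun x => max (g x) 0)
    (g.continuous.max continuous_const) (fun x => le_max_right _ _) hK
    (fun x hx => (B x hx).1) (fun x hx => (B x hx).2.1) (fun x hx => (B x hx).2.2)
    (θ := θ0) (c := c0) θpos rfl
  have hKint : (∫ x in frontier Ω, max (g x) 0 ∂μH[1]) =
      (ϑ^2)⁻¹ * bInt Ω (fun x => (fderiv ℝ κ x (rot (ν x)))^2) := by
    unfold bInt
    rw [← integral_const_mul]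
    refine setIntegral_congr_fun isClosed_frontier.measurableSet (fun x hx => ?_)
    simp only [hK x hx]
    rw [div_pow]; ring
  rw [hKint] at main
  have hQ : ContinuousOn (QQ u) (closure Ω) := by
    unfold QQ
    exact ((((((P.gA 0).ct.pow 2).add ((P.gA 1).ct.pow 2)).add ((P.gB 0).ct.pow 2)).add
      ((P.gB 1).ct.pow 2)).add ((P.gw 0).ct.pow 2)).add ((P.gw 1).ct.pow 2)
  have i1 : derivSq 2 Ω u ≤ 144 * ∫ x in Ω, QQ u x := by
    unfold derivSq
    rw [← integral_const_mul]
    exact setIntegral_mono_on (G.intOn_ct (c2.norm.pow 2)) ((G.intOn_ct hQ).const_mul 144)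
      G.op.measurableSet (fun x hx => hess_le G.op (hu.mono subset_closure) hdiv hx)
  have i2 : (∫ x in Ω, (Ea u x^2 + Eb u x^2 + Om u x^2)) ≤ 3 * ∫ x in Ω, gradNormSq u x := by
    rw [← integral_const_mul]
    refine setIntegral_mono_on (G.intOn_ct (((P.ge1.ct.pow 2).add (P.ge2.ct.pow 2)).add
      (P.gom.ct.pow 2))) (Integrable.const_mul (G.intOn_ct ?_) 3)
      G.op.measurableSet (fun x hx => grad_ge x)
    unfold gradNormSq
    simp only [Fin.sum_univ_two, gradEntry_J]
    exact (((J_ct c1 _ _).pow 2).add ((J_ct c1 _ _).pow 2)).add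
      (((J_ct c1 _ _).pow 2).add ((J_ct c1 _ _).pow 2))
  set X := bInt Ω (fun x => (fderiv ℝ κ x (rot (ν x)))^2)
  set Y := ∫ x in Ω, gradNormSq u x
  have c0pos : 0 < c0 := by unfold c0; positivity
  have main' : (∫ x in Ω, QQ u x) ≤ 2*(θ0*r*(CH*((ϑ^2)⁻¹*X))) +
      2*((2*c0+(12*c0+16000)^2/2)/r^2) * (3 * Y) :=
    main.trans (add_le_add_right (mul_le_mul_of_nonneg_left i2 (by positivity)) _)
  calc ϑ^2 * derivSq 2 Ω u ≤ ϑ^2 * (144 * (2*(θ0*r*(CH*((ϑ^2)⁻¹*X))) +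
      2*((2*c0+(12*c0+16000)^2/2)/r^2) * (3 * Y))) := by
        refine mul_le_mul_of_nonneg_left (i1.trans ?_) (by positivity)
        linarith
    _ = (ϑ^2 * (ϑ^2)⁻¹) * (288 * CH * θ0) * (r * X) + ϑ^2 * (C0 / r^2) * Y := by
        unfold C0; ring
    _ = _ := by
        rw [mul_inv_cancel₀ (by positivity), show 288 * CH * θ0 = 1 by unfold θ0; field_simp]
        ring

lemma rot_cont : Continuous rot := by
  unfold rot
  fun_prop

lemma ubc_bdd (hb : Bornology.IsBounded Ω) (hne : (frontier Ω).Nonempty) :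
    BddAbove {r : ℝ | IsUBCWith Ω r} := by
  obtain ⟨x, hx⟩ := hne
  obtain ⟨M, hM⟩ := hb.exists_norm_le
  refine ⟨M + 1, fun s hs => ?_⟩
  obtain ⟨hs0, hs⟩ := hs
  obtain ⟨a, b, ha, -, -⟩ := hs x hx
  by_contra hlt
  push Not at hlt
  have hM0 : 0 ≤ M := (norm_nonneg _).trans (hM a (ha (mem_ball_self hs0)))
  have key : ∀ v : E2, ‖v‖ = M + 1 → a + v ∈ Ω := fun v hv => ha (by
    rw [mem_ball, dist_eq_norm, add_sub_cancel_left, hv]; exact hlt)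
  have hv : ‖(M+1) • e 0‖ = M + 1 := by
    rw [norm_smul, norm_e, Real.norm_eq_abs, abs_of_pos (by linarith), mul_one]
  have h1 := hM _ (key ((M+1) • e 0) hv)
  have h2 := hM _ (key (-((M+1) • e 0)) (by rw [norm_neg, hv]))
  have h3 := norm_sub_le (a + (M+1) • e 0) (a + -((M+1) • e 0))
  rw [show (a + (M+1) • e 0) - (a + -((M+1) • e 0)) = (2:ℝ) • ((M+1) • e 0) by module,
    norm_smul, hv, Real.norm_two] at h3
  linarith

end


end

/-- Lemma 4.4: for a `C³`-regular solution,
`ϑ² ∫_{Ω_t} |∇²u|² dx ≤ r_t ∫_{∂Ω_t} |∂_{τ_t}κ_t|² dH¹ + ϑ²(C/r_t²) ∫_{Ω_t} |∇u|² dx`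
with an independent constant `C`. -/
theorem H2_control :
    ∃ C : ℝ, ∀ (T ϑ : ℝ) (sol : RegularSolution 3 T ϑ), ∀ t ∈ Ico (0:ℝ) T,
      ϑ^2 * derivSq 2 (sol.Ω t) (sol.u t) ≤
        sol.r t * sol.dcurvSq t +
          ϑ^2 * (C / (sol.r t)^2) * ∫ x in sol.Ω t, gradNormSq (sol.u t) x := by
  refine ⟨4 * C0, fun T ϑ sol t ht => ?_⟩
  have hop := sol.isOpen t ht
  have hbd := sol.isBounded t ht
  have hne := (sol.isConnected t ht).nonempty
  have hfr : (frontier (sol.Ω t)).Nonempty := by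
    by_contra h
    rw [not_nonempty_iff_eq_empty] at h
    have hcl : IsClopen (sol.Ω t) := isClopen_iff_frontier_eq_empty.2 h
    rcases isClopen_iff.1 hcl with h | h
    · exact hne.ne_empty h
    · rw [h] at hbd
      exact NormedSpace.unbounded_univ ℝ E2 hbd
  have hbdd := ubc_bdd hbd hfr
  obtain ⟨s0, hs0⟩ := sol.ubc t ht
  have hrle : ∀ s, IsUBCWith (sol.Ω t) s → s ≤ sol.r t := fun s hs => le_csSup hbdd hs
  have hrpos : 0 < sol.r t := lt_of_lt_of_le hs0.1 (hrle s0 hs0)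
  obtain ⟨s, hs, hs2⟩ := exists_lt_of_lt_csSup (s := {r : ℝ | IsUBCWith (sol.Ω t) r})
    ⟨s0, hs0⟩ (show sol.r t / 2 < sSup _ by
      change sol.r t / 2 < sol.r t; linarith)
  have hs1 := hrle s hs
  have G : Geo (sol.Ω t) s (sol.nu t) :=
    ⟨hs.1, hop, hbd, hne, fun x hx => (sol.nu_normal t ht x hx).1,
      fun x hx => ((sol.nu_normal t ht x hx).2 s hs).1,
      fun x hx => ((sol.nu_normal t ht x hx).2 s hs).2⟩
  have hc : ∀ l : ℕ, l ≤ 3 → ContinuousOn (iteratedFDeriv ℝ l (sol.u t)) (closure (sol.Ω t)) :=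
    fun l hl => (sol.spacetime_cont l hl).comp (f := fun x => (t, x))
      (by fun_prop) (fun x hx => ⟨ht, hx⟩)
  obtain ⟨U, hU, hUf, hUν⟩ := sol.nu_reg t ht
  obtain ⟨V, hV, hVf, hVκ⟩ := sol.kappa_reg t ht
  have hUν' : ContDiffOn ℝ 2 (sol.nu t) U := hUν
  have hVκ' : ContDiffOn ℝ 1 (sol.kappa t) V := hVκ
  have fin := final_geo G (sol.u_reg t ht) (hc 1 (by norm_num)) (hc 2 (by norm_num))
    (hc 3 (by norm_num)) (sol.incomp t ht) sol.theta_pos (sol.p_reg t ht) (sol.stokes t ht)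
    (fun x hx => (hUν'.contDiffAt (hU.mem_nhds (hUf hx))).differentiableAt two_ne_zero)
    (fun x hx => (hVκ'.contDiffAt (hV.mem_nhds (hVf hx))).differentiableAt one_ne_zero)
    (((hVκ'.continuousOn_fderiv_of_isOpen hV le_rfl).mono hVf).clm_apply
      (rot_cont.comp_continuousOn (hUν'.continuousOn.mono hUf)))
    (sol.kappa_eq t ht) (sol.bdry_cond t ht)
  refine fin.trans (add_le_add ?_ ?_)
  · refine mul_le_mul_of_nonneg_right hs1 ?_
    exact integral_nonneg (fun x => sq_nonneg _)
  · refine mul_le_mul_of_nonneg_right (mul_le_mul_of_nonneg_left ?_ (sq_nonneg _))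
      (integral_nonneg (fun x => ?_))
    · have := C0_nonneg
      have hsp := hs.1
      rw [div_le_div_iff₀ (by positivity) (by positivity)]
      have h5 : sol.r t ^ 2 ≤ 4 * s^2 := by nlinarith
      nlinarith
    · exact Finset.sum_nonneg fun i _ => Finset.sum_nonneg fun j _ => sq_nonneg _

end StokesPaper

end
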